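/- There exists a universal constant C > 0 such that for every n, every isotropic log-concave random vector X in ℝⁿ, and every p ≥ 1, one has (E|X|^p)^{1/p} ≤ C·(√n + σ_X(p)), where |·| is the Euclidean norm (the Paouris inequality). -/

import Mathlib

open MeasureTheory ProbabilityTheory Real
open scoped Pointwise ENNReal RealInnerProductSpace

noncomputable section

variable {Ω : Type*} [MeasurableSpace Ω]

/-- A random vector `X` in `ℝⁿ` is log-concave: for all nonempty compact sets `K, L` and
`a ∈ [0,1]`, `P(X ∈ aK + (1-a)L) ≥ P(X ∈ K)^a * P(X ∈ L)^(1-a)`. -/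
def IsLogConcave {n : ℕ} (μ : Measure Ω) (X : Ω → EuclideanSpace ℝ (Fin n)) : Prop :=
  ∀ K L : Set (EuclideanSpace ℝ (Fin n)), K.Nonempty → L.Nonempty →
    IsCompact K → IsCompact L → ∀ a : ℝ, 0 ≤ a → a ≤ 1 →
      (μ (X ⁻¹' K)).toReal ^ a * (μ (X ⁻¹' L)).toReal ^ (1 - a) ≤
        (μ (X ⁻¹' (a • K + (1 - a) • L))).toReal

/-- `X` is isotropic: centered with identity covariance matrix. -/
def IsIsotropic {n : ℕ} (μ : Measure Ω) (X : Ω → EuclideanSpace ℝ (Fin n)) : Prop :=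
  (∀ i, ∫ ω, X ω i ∂μ = 0) ∧
  ∀ i j, ∫ ω, X ω i * X ω j ∂μ = if i = j then (1 : ℝ) else 0

/-- `σ_X(p) = sup_{|t| = 1} (E|⟨t,X⟩|^p)^(1/p)`. -/
def sigmaX {n : ℕ} (μ : Measure Ω) (X : Ω → EuclideanSpace ℝ (Fin n)) (p : ℝ) : ℝ :=
  ⨆ t : {t : EuclideanSpace ℝ (Fin n) // ‖t‖ = 1},
    (∫ ω, |⟪t.1, X ω⟫| ^ p ∂μ) ^ (1 / p)

/-- Generalized inverse of `σ_X`. -/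
def sigmaXInv {n : ℕ} (μ : Measure Ω) (X : Ω → EuclideanSpace ℝ (Fin n)) (s : ℝ) : ℝ :=
  sSup {p : ℝ | 1 ≤ p ∧ sigmaX μ X p ≤ s}

section Gaussian

theorem absolutelyContinuous_pi_fin {μ ν : Measure ℝ} [SigmaFinite μ] [SigmaFinite ν]
    (h : μ ≪ ν) (n : ℕ) :
    Measure.pi (fun _ : Fin n ↦ μ) ≪ Measure.pi (fun _ : Fin n ↦ ν) := by
  induction n with
  | zero =>
    rw [Measure.pi_of_empty (fun _ ↦ μ) default, Measure.pi_of_empty (fun _ ↦ ν) default]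
  | succ n ih =>
    have h1 := (measurePreserving_piFinSuccAbove (fun _ : Fin (n + 1) ↦ μ) 0).symm
    have h2 := (measurePreserving_piFinSuccAbove (fun _ : Fin (n + 1) ↦ ν) 0).symm
    rw [← h1.map_eq, ← h2.map_eq]
    exact (h.prod ih).map h1.measurable

theorem stdGaussian_absolutelyContinuous (n : ℕ) :
    stdGaussian (EuclideanSpace ℝ (Fin n)) ≪ volume := by
  rw [← map_pi_eq_stdGaussian, ← (PiLp.volume_preserving_toLp (Fin n)).map_eq]
  exact (absolutelyContinuous_pi_fin (gaussianReal_absolutelyContinuous 0 one_ne_zero) n).map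
    (by fun_prop)

theorem lintegral_exp_dual_stdGaussian {E : Type*} [NormedAddCommGroup E] [InnerProductSpace ℝ E]
    [FiniteDimensional ℝ E] [MeasurableSpace E] [BorelSpace E] (L : StrongDual ℝ E) :
    ∫⁻ y, ENNReal.ofReal (exp (L y)) ∂stdGaussian E = ENNReal.ofReal (exp (‖L‖ ^ 2 / 2)) := by
  have hmap : (stdGaussian E).map L = gaussianReal 0 (‖L‖₊ ^ 2) := by
    rw [IsGaussian.map_eq_gaussianReal, integral_strongDual_stdGaussian, variance_dual_stdGaussian]
    congr
    ext
    simp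
  have h1 := mgf_gaussianReal hmap 1
  have hint : Integrable (fun y ↦ exp (L y)) (stdGaussian E) := by
    have := integrable_exp_mul_gaussianReal (μ := 0) (v := ‖L‖₊ ^ 2) 1
    rw [← hmap, integrable_map_measure (by fun_prop) (by fun_prop)] at this
    simpa [Function.comp_def] using this
  rw [← ofReal_integral_eq_lintegral_ofReal hint (ae_of_all _ fun _ ↦ (exp_pos _).le)]
  simp only [mgf, one_mul, zero_add, one_pow, mul_one] at h1
  rw [h1]
  simp

theorem ofReal_exp_integral_le {α : Type*} [MeasurableSpace α] {μ : Measure α}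
    [IsProbabilityMeasure μ] {g : α → ℝ} (hg : Integrable g μ) :
    ENNReal.ofReal (exp (∫ x, g x ∂μ)) ≤ ∫⁻ x, ENNReal.ofReal (exp (g x)) ∂μ := by
  by_cases h : Integrable (fun x ↦ exp (g x)) μ
  · rw [← ofReal_integral_eq_lintegral_ofReal h (ae_of_all _ fun _ ↦ (exp_pos _).le)]
    exact ENNReal.ofReal_le_ofReal (convexOn_exp.map_integral_le continuous_exp.continuousOn
      isClosed_univ (by simp) hg h)
  · have : ∫⁻ x, ENNReal.ofReal (exp (g x)) ∂μ = ∞ := by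
      by_contra hne
      refine h ⟨continuous_exp.comp_aestronglyMeasurable hg.1, ?_⟩
      rw [hasFiniteIntegral_iff_ofReal (ae_of_all _ fun _ ↦ (exp_pos _).le)]
      exact lt_top_iff_ne_top.2 hne
    simp [this]

theorem lintegral_exp_sub_le_of_lipschitz {E : Type*} [NormedAddCommGroup E]
    [InnerProductSpace ℝ E] [FiniteDimensional ℝ E] [MeasurableSpace E] [BorelSpace E]
    {m : Measure E} [m.IsAddHaarMeasure] (hm : stdGaussian E ≪ m) {F : E → ℝ} {L : NNReal}
    (hF : LipschitzWith L F) :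
    ∫⁻ z, ENNReal.ofReal (exp (F z.2 - F z.1)) ∂((stdGaussian E).prod (stdGaussian E)) ≤
      ENNReal.ofReal (exp (π ^ 2 * L ^ 2 / 8)) := by
  set γ := stdGaussian E
  set ρ : Measure ℝ := ENNReal.ofReal (2 / π) • volume.restrict (Set.Ioc 0 (π / 2)) with hρ
  have hρ1 : IsProbabilityMeasure ρ := by
    constructor
    simp only [hρ, Measure.smul_apply, Measure.restrict_apply MeasurableSet.univ, Set.univ_inter,
      Real.volume_Ioc, smul_eq_mul]
    rw [← ENNReal.ofReal_mul (by positivity), ← ENNReal.ofReal_one]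
    congr 1
    field_simp
    simp
  -- the directional derivative of `F` along the rotated pair
  let D : E × E → ℝ := fun z ↦ fderiv ℝ F z.1 z.2
  have hD : Measurable D := by
    have h1 : Measurable (fun z : E × E ↦ fderiv ℝ F z.1) :=
      (measurable_fderiv ℝ F).comp measurable_fst
    have h2 : Continuous fun q : (E →L[ℝ] ℝ) × E ↦ q.1 q.2 := by fun_prop
    exact h2.measurable.comp (h1.prodMk measurable_snd)
  have hrot : Continuous (fun q : (E × E) × ℝ ↦ ContinuousLinearMap.rotation q.2 q.1) := by
    simp only [ContinuousLinearMap.rotation_apply]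
    fun_prop
  have hinv : ∀ θ : ℝ, (γ.prod γ).map (ContinuousLinearMap.rotation θ) = γ.prod γ := fun θ ↦
    IsGaussian.map_rotation_eq_self integral_id_stdGaussian θ
  have hder : ∀ (z : E × E) (θ : ℝ), HasDerivAt
      (fun s ↦ (ContinuousLinearMap.rotation s z).1) (ContinuousLinearMap.rotation θ z).2 θ := by
    intro z θ
    simp only [ContinuousLinearMap.rotation_apply]
    exact ((hasDerivAt_cos θ).smul_const z.1).add ((hasDerivAt_sin θ).smul_const z.2)
  have hdiff : ∀ᵐ z ∂(γ.prod γ), ∀ᵐ θ ∂ρ,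
      DifferentiableAt ℝ F (ContinuousLinearMap.rotation θ z).1 := by
    have hms : MeasurableSet {q : (E × E) × ℝ |
        DifferentiableAt ℝ F (ContinuousLinearMap.rotation q.2 q.1).1} :=
      (measurableSet_of_differentiableAt ℝ F).preimage (measurable_fst.comp hrot.measurable)
    refine (Measure.ae_ae_comm hms).2 (ae_of_all _ fun θ ↦ ?_)
    have h0 : ∀ᵐ x ∂γ, DifferentiableAt ℝ F x :=
      hm.ae_le hF.ae_differentiableAt
    have h1 : ∀ᵐ z ∂(γ.prod γ), DifferentiableAt ℝ F z.1 :=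
      Measure.quasiMeasurePreserving_fst.ae h0
    rw [← hinv θ] at h1
    exact ae_of_ae_map (ContinuousLinearMap.rotation θ).continuous.aemeasurable h1
  have hpt : ∀ᵐ z ∂(γ.prod γ), ENNReal.ofReal (exp (F z.2 - F z.1)) ≤
      ∫⁻ θ, ENNReal.ofReal (exp (π / 2 * D (ContinuousLinearMap.rotation θ z))) ∂ρ := by
    filter_upwards [hdiff] with z hz
    set φ : ℝ → ℝ := fun θ ↦ F (ContinuousLinearMap.rotation θ z).1 with hφ
    have hlip : LipschitzWith (L * ((‖z.1‖₊ + ‖z.2‖₊))) φ := by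
      refine hF.comp ?_
      refine lipschitzWith_of_nnnorm_deriv_le (fun θ ↦ (hder z θ).differentiableAt) fun θ ↦ ?_
      rw [(hder z θ).deriv, ContinuousLinearMap.rotation_apply]
      refine (nnnorm_add_le _ _).trans (add_le_add ?_ ?_)
      · rw [nnnorm_smul, nnnorm_neg]
        exact mul_le_of_le_one_left zero_le (abs_sin_le_one θ)
      · rw [nnnorm_smul]
        exact mul_le_of_le_one_left zero_le (abs_cos_le_one θ)
    have hac := (hlip.lipschitzOnWith (s := Set.uIcc 0 (π / 2))).absolutelyContinuousOnInterval
    have hftc := hac.integral_deriv_eq_sub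
    have hii := hac.intervalIntegrable_deriv
    rw [intervalIntegrable_iff_integrableOn_Ioc_of_le (by positivity)] at hii
    rw [intervalIntegral.integral_of_le (by positivity)] at hftc
    have hae : ∀ᵐ θ ∂ρ, deriv φ θ = D (ContinuousLinearMap.rotation θ z) := by
      filter_upwards [hz] with θ hθ
      exact (hθ.hasFDerivAt.comp_hasDerivAt θ (hder z θ)).deriv
    have hint : Integrable (fun θ ↦ π / 2 * deriv φ θ) ρ :=
      (Integrable.smul_measure hii ENNReal.ofReal_ne_top).const_mul _
    have hval : ∫ θ, π / 2 * deriv φ θ ∂ρ = F z.2 - F z.1 := by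
      rw [integral_const_mul, hρ, integral_smul_measure, hftc,
        ENNReal.toReal_ofReal (by positivity), smul_eq_mul, hφ]
      simp only [ContinuousLinearMap.rotation_apply]
      simp
      field_simp
    rw [← hval]
    refine (ofReal_exp_integral_le hint).trans_eq (lintegral_congr_ae ?_)
    filter_upwards [hae] with θ hθ
    rw [hθ]
  have hDm : Measurable fun z ↦ ENNReal.ofReal (exp (π / 2 * D z)) :=
    ENNReal.measurable_ofReal.comp (measurable_exp.comp (hD.const_mul _))
  calc _ ≤ ∫⁻ z, ∫⁻ θ,
          ENNReal.ofReal (exp (π / 2 * D (ContinuousLinearMap.rotation θ z))) ∂ρ ∂(γ.prod γ) :=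
        lintegral_mono_ae hpt
    _ = ∫⁻ θ, ∫⁻ z,
          ENNReal.ofReal (exp (π / 2 * D (ContinuousLinearMap.rotation θ z))) ∂(γ.prod γ) ∂ρ := by
        refine lintegral_lintegral_swap ?_
        exact (hDm.comp hrot.measurable).aemeasurable
    _ = ∫⁻ _, ∫⁻ z, ENNReal.ofReal (exp (π / 2 * D z)) ∂(γ.prod γ) ∂ρ := by
        refine lintegral_congr fun θ ↦ ?_
        conv_rhs => rw [← hinv θ]
        rw [lintegral_map hDm (ContinuousLinearMap.rotation θ).continuous.measurable]
    _ = ∫⁻ x, ∫⁻ y, ENNReal.ofReal (exp (π / 2 * D (x, y))) ∂γ ∂γ := by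
        rw [lintegral_const, measure_univ, mul_one, lintegral_prod _ hDm.aemeasurable]
    _ ≤ ∫⁻ _, ENNReal.ofReal (exp (π ^ 2 * L ^ 2 / 8)) ∂γ := by
        refine lintegral_mono fun x ↦ ?_
        have := lintegral_exp_dual_stdGaussian ((π / 2) • fderiv ℝ F x)
        simp only [FunLike.coe_smul, Pi.smul_apply, smul_eq_mul] at this
        rw [this]
        refine ENNReal.ofReal_le_ofReal (exp_le_exp.2 ?_)
        have hn : ‖fderiv ℝ F x‖ ≤ L := norm_fderiv_le_of_lipschitz ℝ hF
        rw [norm_smul, norm_of_nonneg (by positivity : (0:ℝ) ≤ π / 2)]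
        have : ‖fderiv ℝ F x‖ ^ 2 ≤ L ^ 2 := by gcongr
        nlinarith [sq_nonneg π]
    _ = _ := by simp

theorem lipschitz_integrable_stdGaussian {n : ℕ} {F : EuclideanSpace ℝ (Fin n) → ℝ} {L : NNReal}
    (hF : LipschitzWith L F) : Integrable F (stdGaussian (EuclideanSpace ℝ (Fin n))) := by
  have h1 : Integrable (fun x : EuclideanSpace ℝ (Fin n) ↦ |F 0| + L * ‖x‖)
      (stdGaussian (EuclideanSpace ℝ (Fin n))) :=
    (integrable_const _).add ((IsGaussian.integrable_id).norm.const_mul _)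
  refine h1.mono' hF.continuous.aestronglyMeasurable (ae_of_all _ fun x ↦ ?_)
  have := hF.dist_le_mul x 0
  rw [dist_zero_right, Real.dist_eq] at this
  rw [Real.norm_eq_abs]
  have h3 := abs_sub_abs_le_abs_sub (F x) (F 0)
  linarith

/-- Gaussian concentration: the exponential moment of a centred Lipschitz function. -/
theorem lintegral_exp_sub_integral_le {n : ℕ} {F : EuclideanSpace ℝ (Fin n) → ℝ} {L : NNReal}
    (hF : LipschitzWith L F) :
    ∫⁻ x, ENNReal.ofReal (exp (F x - ∫ y, F y ∂stdGaussian (EuclideanSpace ℝ (Fin n))))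
      ∂stdGaussian (EuclideanSpace ℝ (Fin n)) ≤ ENNReal.ofReal (exp (π ^ 2 * L ^ 2 / 8)) := by
  refine le_trans ?_ (lintegral_exp_sub_le_of_lipschitz (stdGaussian_absolutelyContinuous n) hF)
  have hm : Measurable F := hF.continuous.measurable
  rw [lintegral_prod_symm _ (by fun_prop)]
  refine lintegral_mono fun x ↦ ?_
  have hi := lipschitz_integrable_stdGaussian hF
  have := ofReal_exp_integral_le ((integrable_const (F x)).sub hi)
  simpa [integral_sub (integrable_const (F x)) hi] using this

end Gaussian
section SmallMoment

theorem add_rpow_le_two_rpow_mul {a b p : ℝ} (ha : 0 ≤ a) (hb : 0 ≤ b) (hp : 0 ≤ p) :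
    (a + b) ^ p ≤ 2 ^ p * (a ^ p + b ^ p) := by
  rcases le_total a b with h | h
  · calc (a + b) ^ p ≤ (2 * b) ^ p := by gcongr; linarith
      _ = 2 ^ p * b ^ p := mul_rpow (by norm_num) hb
      _ ≤ _ := by gcongr; linarith [rpow_nonneg ha p]
  · calc (a + b) ^ p ≤ (2 * a) ^ p := by gcongr; linarith
      _ = 2 ^ p * a ^ p := mul_rpow (by norm_num) ha
      _ ≤ _ := by gcongr; linarith [rpow_nonneg hb p]

variable {E : Type*} [NormedAddCommGroup E] [InnerProductSpace ℝ E] [MeasurableSpace E]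

/-- The measures of balls of radius `R` depend log-concavely on the centre. -/
def BallLogConcave (ν : Measure E) (R : ℝ) : Prop :=
  ∀ u v : E, ∀ a : ℝ, 0 < a → a < 1 →
    ν.real (Metric.closedBall u R) ^ a * ν.real (Metric.closedBall v R) ^ (1 - a) ≤
      ν.real (Metric.closedBall (a • u + (1 - a) • v) R)

variable {ν : Measure E} {R : ℝ}

theorem BallLogConcave.convex (h : BallLogConcave ν R) {δ : ℝ} (hδ : 0 < δ) :
    Convex ℝ {v | δ ≤ ν.real (Metric.closedBall v R)} := by
  refine convex_iff_forall_pos.2 fun u hu v hv a b ha hb hab ↦ ?_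
  obtain rfl : b = 1 - a := by linarith
  refine le_trans ?_ (h u v a ha (by linarith))
  calc δ = δ ^ a * δ ^ (1 - a) := by rw [← rpow_add hδ]; simp
    _ ≤ _ := by
      have h1 : δ ^ a ≤ ν.real (Metric.closedBall u R) ^ a := rpow_le_rpow hδ.le hu ha.le
      have h2 : δ ^ (1 - a) ≤ ν.real (Metric.closedBall v R) ^ (1 - a) :=
        rpow_le_rpow hδ.le hv hb.le
      gcongr

theorem BallLogConcave.le_half_smul (h : BallLogConcave ν R)
    (h0 : 1 / 2 ≤ ν.real (Metric.closedBall 0 R)) (v : E) :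
    ν.real (Metric.closedBall v R) ≤ 2 * ν.real (Metric.closedBall ((1 / 2 : ℝ) • v) R) ^ 2 := by
  have h1 := h v 0 (1 / 2) (by norm_num) (by norm_num)
  rw [smul_zero, add_zero] at h1
  have hx : 0 ≤ ν.real (Metric.closedBall v R) := measureReal_nonneg
  have hy : 0 ≤ ν.real (Metric.closedBall (0 : E) R) := measureReal_nonneg
  have h2 : (ν.real (Metric.closedBall v R) ^ (1 / 2 : ℝ) *
      ν.real (Metric.closedBall (0 : E) R) ^ (1 - 1 / 2 : ℝ)) ^ 2 =
      ν.real (Metric.closedBall v R) * ν.real (Metric.closedBall (0 : E) R) := by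
    rw [show (1 - 1 / 2 : ℝ) = 1 / 2 by norm_num, ← sqrt_eq_rpow, ← sqrt_eq_rpow, mul_pow,
      sq_sqrt hx, sq_sqrt hy]
  have h3 := pow_le_pow_left₀ (by positivity) h1 2
  rw [h2] at h3
  nlinarith

variable [FiniteDimensional ℝ E] [BorelSpace E]

theorem measurableSet_prod_dist_le (R : ℝ) : MeasurableSet {q : E × E | dist q.1 q.2 ≤ R} :=
  measurableSet_le (by fun_prop) measurable_const

theorem measurable_measure_closedBall (ν : Measure E) [SFinite ν] (R : ℝ) :
    Measurable fun v ↦ ν (Metric.closedBall v R) := by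
  have := measurable_measure_prodMk_right (μ := ν) (measurableSet_prod_dist_le (E := E) R)
  exact this

variable [IsProbabilityMeasure ν]

theorem lintegral_mul_measure_closedBall {φ : E → ℝ≥0∞} (hφ : Measurable φ) :
    ∫⁻ v, φ v * ν (Metric.closedBall v R) = ∫⁻ y, (∫⁻ v in Metric.closedBall y R, φ v) ∂ν := by
  have h1 : ∀ v, φ v * ν (Metric.closedBall v R) =
      ∫⁻ y, {q : E × E | dist q.1 q.2 ≤ R}.indicator (fun q ↦ φ q.1) (v, y) ∂ν := by
    intro v
    have : ∀ y, {q : E × E | dist q.1 q.2 ≤ R}.indicator (fun q ↦ φ q.1) (v, y) =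
        (Metric.closedBall v R).indicator (fun _ ↦ φ v) y := by
      intro y
      simp only [Set.indicator, Set.mem_ofPred_eq, Metric.mem_closedBall, dist_comm y v]
    simp_rw [this]
    rw [lintegral_indicator_const Metric.isClosed_closedBall.measurableSet]
  simp_rw [h1]
  rw [lintegral_lintegral_swap]
  · refine lintegral_congr fun y ↦ ?_
    rw [← lintegral_indicator Metric.isClosed_closedBall.measurableSet]
    rfl
  · exact ((hφ.comp measurable_fst).indicator (measurableSet_prod_dist_le R)).aemeasurable

theorem lintegral_measure_closedBall :
    ∫⁻ v, ν (Metric.closedBall v R) = volume (Metric.closedBall (0 : E) R) := by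
  have := lintegral_mul_measure_closedBall (ν := ν) (R := R) (φ := fun _ : E ↦ 1) measurable_const
  simp only [one_mul, lintegral_one, Measure.restrict_apply MeasurableSet.univ,
    Set.univ_inter] at this
  rw [this]
  simp_rw [Measure.addHaar_closedBall_center]
  simp

theorem volume_closure_mul_le (h : BallLogConcave ν R) {δ : ℝ} (hδ : 0 < δ) :
    ENNReal.ofReal δ * volume (closure {v : E | δ ≤ ν.real (Metric.closedBall v R)}) ≤
      volume (Metric.closedBall (0 : E) R) := by
  have hc := (h.convex hδ).addHaar_frontier volume
  set D := {v : E | δ ≤ ν.real (Metric.closedBall v R)}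
  have h1 : volume (closure D) ≤ volume D := by
    rw [closure_eq_self_union_frontier]
    exact (measure_union_le _ _).trans (by rw [hc, add_zero])
  rw [← lintegral_measure_closedBall (ν := ν)]
  refine (mul_le_mul_right h1 _).trans ?_
  refine le_trans (mul_le_mul_right (measure_mono ?_) _)
    (mul_meas_ge_le_lintegral (measurable_measure_closedBall ν R) (ENNReal.ofReal δ))
  intro v hv
  exact ENNReal.ofReal_le_of_le_toReal hv

theorem exists_notMem_closure (h : BallLogConcave ν R) (hR : 0 < R) {δ r : ℝ} (hδ : 0 < δ)
    (hr : 0 < r) (hlt : R ^ Module.finrank ℝ E < δ * r ^ Module.finrank ℝ E) :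
    ∃ u : E, ‖u‖ ≤ r ∧ u ∉ closure {v : E | δ ≤ ν.real (Metric.closedBall v R)} := by
  by_contra! hcon
  have hsub : Metric.closedBall (0 : E) r ⊆
      closure {v : E | δ ≤ ν.real (Metric.closedBall v R)} := fun u hu ↦ hcon u (by simpa using hu)
  have h1 := (mul_le_mul_right (measure_mono hsub) (ENNReal.ofReal δ)).trans
    (volume_closure_mul_le h hδ)
  rw [Measure.addHaar_closedBall _ _ hr.le, Measure.addHaar_closedBall _ _ hR.le, ← mul_assoc,
    ← ENNReal.ofReal_mul hδ.le] at h1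
  have h2 := (ENNReal.mul_le_mul_iff_left (Metric.measure_ball_pos volume (0 : E) one_pos).ne'
    measure_ball_lt_top.ne).1 h1
  rw [ENNReal.ofReal_le_ofReal_iff (by positivity)] at h2
  linarith

theorem exists_unit_measure_closedBall_lt (h : BallLogConcave ν R) (hR : 0 < R) {δ r : ℝ}
    (hδ : 0 < δ) (hr : 0 < r) (h0 : δ ≤ ν.real (Metric.closedBall 0 R))
    (hlt : R ^ Module.finrank ℝ E < δ * r ^ Module.finrank ℝ E) :
    ∃ t : E, ‖t‖ = 1 ∧ ∀ v, r ≤ ⟪t, v⟫ → ν.real (Metric.closedBall v R) < δ := by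
  obtain ⟨u, hu, hnot⟩ := exists_notMem_closure h hR hδ hr hlt
  obtain ⟨f, s, hf, hs⟩ := geometric_hahn_banach_closed_point (h.convex hδ).closure isClosed_closure
    hnot
  obtain ⟨w, rfl⟩ := (InnerProductSpace.toDual ℝ E).surjective f
  simp only [InnerProductSpace.toDual_apply_apply] at hf hs
  have hs0 : 0 < s := by simpa using hf 0 (subset_closure h0)
  have hw : 0 < ‖w‖ := by
    rw [norm_pos_iff]
    rintro rfl
    simp only [inner_zero_left] at hs
    linarith
  refine ⟨‖w‖⁻¹ • w, by rw [norm_smul, norm_inv, norm_norm, inv_mul_cancel₀ hw.ne'],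
    fun v hv ↦ ?_⟩
  by_contra! hcon
  have h1 := hf v (subset_closure hcon)
  rw [real_inner_smul_left, le_inv_mul_iff₀ hw] at hv
  have h2 := real_inner_le_norm w u
  nlinarith

theorem lintegral_comp_half_smul (ψ : E → ℝ≥0∞) (hψ : Measurable ψ) :
    ∫⁻ v, ψ ((1 / 2 : ℝ) • v) = ENNReal.ofReal (2 ^ Module.finrank ℝ E) * ∫⁻ v, ψ v := by
  rw [← lintegral_map (f := ψ) (g := fun v : E ↦ (1 / 2 : ℝ) • v) hψ (by fun_prop),
    Measure.map_addHaar_smul volume (by norm_num : (1 / 2 : ℝ) ≠ 0), lintegral_smul_measure,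
    smul_eq_mul]
  congr 2
  rw [abs_of_pos (by positivity)]
  simp

theorem lintegral_rpow_mul_measure_closedBall_lt_top {p : ℝ} (hp : 0 ≤ p) (hR : 0 ≤ R)
    (hfin : ∫⁻ y, ENNReal.ofReal (‖y‖ ^ p) ∂ν < ∞) :
    ∫⁻ v, ENNReal.ofReal (‖v‖ ^ p) * ν (Metric.closedBall v R) < ∞ := by
  rw [lintegral_mul_measure_closedBall (by fun_prop)]
  calc ∫⁻ y, (∫⁻ v in Metric.closedBall y R, ENNReal.ofReal (‖v‖ ^ p)) ∂ν
      ≤ ∫⁻ y, ENNReal.ofReal (2 ^ p * (‖y‖ ^ p + R ^ p)) *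
        volume (Metric.closedBall (0 : E) R) ∂ν := by
        refine lintegral_mono fun y ↦ ?_
        rw [← Measure.addHaar_closedBall_center volume y R, ← setLIntegral_const]
        refine setLIntegral_mono' Metric.isClosed_closedBall.measurableSet fun v hv ↦ ?_
        refine ENNReal.ofReal_le_ofReal (le_trans ?_ (add_rpow_le_two_rpow_mul (norm_nonneg _) hR hp))
        have := norm_le_of_mem_closedBall hv
        gcongr
    _ = ENNReal.ofReal (2 ^ p) * (∫⁻ y, ENNReal.ofReal (‖y‖ ^ p) ∂ν + ENNReal.ofReal (R ^ p)) *
        volume (Metric.closedBall (0 : E) R) := by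
        rw [lintegral_mul_const _ (by fun_prop)]
        simp_rw [ENNReal.ofReal_mul (show (0 : ℝ) ≤ 2 ^ p by positivity),
          ENNReal.ofReal_add (rpow_nonneg (norm_nonneg _) p) (rpow_nonneg hR p)]
        rw [lintegral_const_mul _ (by fun_prop), lintegral_add_left (by fun_prop)]
        simp
    _ < ∞ := by
        refine ENNReal.mul_lt_top (ENNReal.mul_lt_top ENNReal.ofReal_lt_top
          (ENNReal.add_lt_top.2 ⟨hfin, ENNReal.ofReal_lt_top⟩)) ?_
        exact measure_closedBall_lt_top

/-- If a ball-log-concave measure `ν` on a space of dimension at least `p` gives mass at least `1/2`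
to the ball of radius `R`, then some one-sided marginal of `ν` has `p`-th moment of order `R`. -/
theorem exists_unit_lintegral_posPart_rpow_le (h : BallLogConcave ν R) (hR : 0 < R) {p : ℝ}
    (hp : 1 ≤ p) (hpk : p ≤ Module.finrank ℝ E) (h0 : 1 / 2 ≤ ν.real (Metric.closedBall 0 R))
    (hfin : ∫⁻ y, ENNReal.ofReal (‖y‖ ^ p) ∂ν < ∞) :
    ∃ t : E, ‖t‖ = 1 ∧
      ∫⁻ y, ENNReal.ofReal ((max ⟪t, y⟫ 0) ^ p) ∂ν ≤ ENNReal.ofReal ((512 * R) ^ p) := by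
  set k := Module.finrank ℝ E with hk
  have hk1 : 1 ≤ k := by
    have : (1 : ℝ) ≤ k := hp.trans hpk
    exact_mod_cast this
  have hp0 : 0 < p := by linarith
  set δ : ℝ := 1 / 4 * (1 / 4) ^ k with hδdef
  set r : ℝ := 32 * R with hr
  have hδ : 0 < δ := by positivity
  have hδ' : δ ≤ 1 / 2 := by
    have : (1 / 4 : ℝ) ^ k ≤ 1 := pow_le_one₀ (by norm_num) (by norm_num)
    linarith
  have hlt : R ^ k < δ * r ^ k := by
    have h8 : (8 : ℝ) ≤ 8 ^ k := le_self_pow₀ (by norm_num) (by omega)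
    have : δ * r ^ k = 1 / 4 * 8 ^ k * R ^ k := by
      rw [hδdef, hr, mul_pow, show (8 : ℝ) = 1 / 4 * 32 by norm_num, mul_pow]
      ring
    rw [this]
    have hRk : 0 < R ^ k := by positivity
    nlinarith
  obtain ⟨t, ht, hH⟩ := exists_unit_measure_closedBall_lt h hR hδ (by positivity)
    (hδ'.trans h0) hlt
  refine ⟨t, ht, ?_⟩
  set V := volume (Metric.closedBall (0 : E) R) with hV
  have hV0 : V ≠ 0 := (Metric.measure_closedBall_pos volume _ hR).ne'
  have hVt : V ≠ ∞ := measure_closedBall_lt_top.ne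
  set g : E → ℝ≥0∞ := fun v ↦ ν (Metric.closedBall v R) with hg
  have hgm : Measurable g := measurable_measure_closedBall ν R
  set q : E → ℝ≥0∞ := fun v ↦ ENNReal.ofReal ((max ⟪t, v⟫ 0) ^ p) with hq
  have hqm : Measurable q := by
    have : Measurable fun v : E ↦ max ⟪t, v⟫ 0 := by fun_prop
    fun_prop
  have hint : ∫⁻ v, g v = V := lintegral_measure_closedBall
  have hm : ∀ s : ℝ, MeasurableSet {v : E | s ≤ ⟪t, v⟫} := fun s ↦
    measurableSet_le measurable_const (by fun_prop)
  set J := ∫⁻ v in {v : E | r ≤ ⟪t, v⟫}, q v * g v with hJ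
  have hqle : ∀ v, q v ≤ ENNReal.ofReal (‖v‖ ^ p) := by
    intro v
    refine ENNReal.ofReal_le_ofReal (rpow_le_rpow (le_max_right _ _) (max_le ?_ (norm_nonneg _))
      hp0.le)
    simpa [ht] using real_inner_le_norm t v
  have hJfin : J ≠ ∞ := by
    refine ne_top_of_le_ne_top
      (lintegral_rpow_mul_measure_closedBall_lt_top hp0.le hR.le hfin).ne ?_
    refine (setLIntegral_le_lintegral _ _).trans (lintegral_mono fun v ↦ ?_)
    exact mul_le_mul_left (hqle v) _
  have hlow : ∀ s : ℝ, 0 ≤ s → ∀ S : Set E, MeasurableSet S → (∀ v ∈ S, ⟪t, v⟫ ≤ s) →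
      ∫⁻ v in S, q v * g v ≤ ENNReal.ofReal (s ^ p) * V := by
    intro s hs S hS hS'
    rw [← hint, ← lintegral_const_mul _ hgm]
    refine (setLIntegral_mono' hS fun v hv ↦ ?_).trans (setLIntegral_le_lintegral _ _)
    refine mul_le_mul_left (ENNReal.ofReal_le_ofReal ?_) _
    exact rpow_le_rpow (le_max_right _ _) (max_le (hS' v hv) hs) hp0.le
  have hhalf : ∀ v, 2 * r ≤ ⟪t, v⟫ → q v * g v ≤ ENNReal.ofReal (2 * δ * 2 ^ p) *
      {v : E | r ≤ ⟪t, v⟫}.indicator (fun v ↦ q v * g v) ((1 / 2 : ℝ) • v) := by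
    intro v hv
    have hin : ⟪t, (1 / 2 : ℝ) • v⟫ = 1 / 2 * ⟪t, v⟫ := real_inner_smul_right _ _ _
    have hmem : r ≤ ⟪t, (1 / 2 : ℝ) • v⟫ := by rw [hin]; linarith
    rw [Set.indicator_of_mem (by exact hmem)]
    have hq2 : q v = ENNReal.ofReal (2 ^ p) * q ((1 / 2 : ℝ) • v) := by
      simp only [hq]
      rw [← ENNReal.ofReal_mul (by positivity), ← mul_rpow (by norm_num) (le_max_right _ _), hin,
        mul_max_of_nonneg _ _ (by norm_num : (0 : ℝ) ≤ 2)]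
      congr 3
      · ring
      · ring
    have hg2 : g v ≤ ENNReal.ofReal (2 * δ) * g ((1 / 2 : ℝ) • v) := by
      simp only [hg]
      rw [← ofReal_measureReal (μ := ν) (s := Metric.closedBall v R),
        ← ofReal_measureReal (μ := ν) (s := Metric.closedBall ((1 / 2 : ℝ) • v) R),
        ← ENNReal.ofReal_mul (by positivity)]
      refine ENNReal.ofReal_le_ofReal ((h.le_half_smul h0 v).trans ?_)
      have h1 := hH _ hmem
      have h2 : 0 ≤ ν.real (Metric.closedBall ((1 / 2 : ℝ) • v) R) := measureReal_nonneg
      nlinarith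
    rw [hq2, mul_comm (2 * δ), ENNReal.ofReal_mul (by positivity)]
    calc _ ≤ ENNReal.ofReal (2 ^ p) * q ((1 / 2 : ℝ) • v) *
          (ENNReal.ofReal (2 * δ) * g ((1 / 2 : ℝ) • v)) := mul_le_mul_right hg2 _
      _ = _ := by ring
  have hJ2 : ∫⁻ v in {v : E | 2 * r ≤ ⟪t, v⟫}, q v * g v ≤ ENNReal.ofReal (1 / 2) * J := by
    calc _ ≤ ∫⁻ v, ENNReal.ofReal (2 * δ * 2 ^ p) *
          {v : E | r ≤ ⟪t, v⟫}.indicator (fun v ↦ q v * g v) ((1 / 2 : ℝ) • v) :=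
          (setLIntegral_mono' (hm _) hhalf).trans (setLIntegral_le_lintegral _ _)
      _ = ENNReal.ofReal (2 * δ * 2 ^ p) * (ENNReal.ofReal (2 ^ k) * J) := by
          have hmi := (hqm.mul hgm).indicator (hm r)
          rw [lintegral_const_mul' _ _ ENNReal.ofReal_ne_top]
          congr 1
          refine (lintegral_comp_half_smul _ hmi).trans ?_
          rw [hJ, ← lintegral_indicator (hm r)]
          rfl
      _ = ENNReal.ofReal (2 * δ * 2 ^ p * 2 ^ k) * J := by
          rw [← mul_assoc, ← ENNReal.ofReal_mul (by positivity)]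
      _ ≤ _ := by
          refine mul_le_mul_left (ENNReal.ofReal_le_ofReal ?_) _
          have h2p : (2 : ℝ) ^ p ≤ 2 ^ k := by
            rw [← rpow_natCast]
            exact rpow_le_rpow_of_exponent_le (by norm_num) hpk
          calc 2 * δ * 2 ^ p * 2 ^ k ≤ 2 * δ * 2 ^ k * 2 ^ k := by gcongr
            _ = 1 / 2 * ((1 / 4) * 2 * 2) ^ k := by rw [hδdef, mul_pow, mul_pow]; ring
            _ = 1 / 2 := by norm_num
  have hr0 : 0 < r := by positivity
  have hJle : J ≤ ENNReal.ofReal (2 * (2 * r) ^ p) * V := by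
    have h1 : J ≤ ENNReal.ofReal ((2 * r) ^ p) * V + ENNReal.ofReal (1 / 2) * J := by
      refine le_trans ?_ (add_le_add (hlow (2 * r) (by positivity)
        ({v : E | r ≤ ⟪t, v⟫} \ {v : E | 2 * r ≤ ⟪t, v⟫}) ((hm _).diff (hm _)) ?_) hJ2)
      · refine (lintegral_mono_set ?_).trans (lintegral_union_le _ _ _)
        intro v hv
        by_cases h2 : 2 * r ≤ ⟪t, v⟫
        · exact Or.inr h2
        · exact Or.inl ⟨hv, h2⟩
      · intro v hv
        exact (not_le.1 hv.2).le
    rw [← ENNReal.ofReal_toReal hJfin, ← ENNReal.ofReal_toReal hVt, ← ENNReal.ofReal_mul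
      (by positivity), ← ENNReal.ofReal_mul (by positivity), ← ENNReal.ofReal_add (by positivity)
      (by positivity), ENNReal.ofReal_le_ofReal_iff (by positivity)] at h1
    rw [← ENNReal.ofReal_toReal hJfin, ← ENNReal.ofReal_toReal hVt, ← ENNReal.ofReal_mul
      (by positivity)]
    exact ENNReal.ofReal_le_ofReal (by linarith)
  have hall : ∫⁻ v, q v * g v ≤ ENNReal.ofReal (r ^ p + 2 * (2 * r) ^ p) * V := by
    rw [← lintegral_add_compl _ (hm r), add_comm, ENNReal.ofReal_add (by positivity)
      (by positivity), add_mul]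
    refine add_le_add (hlow r hr0.le _ (hm r).compl fun v hv ↦ ?_) hJle
    exact (not_le.1 (show ¬ r ≤ ⟪t, v⟫ from hv)).le
  have hmain : (∫⁻ y, q y ∂ν) * V ≤
      ENNReal.ofReal (2 ^ p * (r ^ p + 2 * (2 * r) ^ p + R ^ p)) * V := by
    calc (∫⁻ y, q y ∂ν) * V = ∫⁻ y, (∫⁻ _ in Metric.closedBall y R, q y) ∂ν := by
          rw [← lintegral_mul_const _ hqm]
          refine lintegral_congr fun y ↦ ?_
          rw [setLIntegral_const, Measure.addHaar_closedBall_center]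
      _ ≤ ∫⁻ y, (∫⁻ v in Metric.closedBall y R,
            ENNReal.ofReal (2 ^ p) * (q v + ENNReal.ofReal (R ^ p))) ∂ν := by
          refine lintegral_mono fun y ↦ ?_
          refine setLIntegral_mono' Metric.isClosed_closedBall.measurableSet fun v hv ↦ ?_
          rw [← ENNReal.ofReal_add (by positivity) (by positivity),
            ← ENNReal.ofReal_mul (by positivity)]
          refine ENNReal.ofReal_le_ofReal (le_trans ?_
            (add_rpow_le_two_rpow_mul (le_max_right _ _) hR.le hp0.le))
          refine rpow_le_rpow (le_max_right _ _) (max_le ?_ (by positivity)) hp0.le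
          have h1 : ⟪t, y⟫ = ⟪t, v⟫ + ⟪t, y - v⟫ := by rw [inner_sub_right]; ring
          have h2 := real_inner_le_norm t (y - v)
          rw [Metric.mem_closedBall, dist_comm, dist_eq_norm] at hv
          rw [ht, one_mul] at h2
          linarith [le_max_left ⟪t, v⟫ 0]
      _ = ENNReal.ofReal (2 ^ p) * ((∫⁻ v, q v * g v) + ENNReal.ofReal (R ^ p) * V) := by
          rw [← lintegral_mul_measure_closedBall (by fun_prop)]
          simp_rw [mul_assoc]
          rw [lintegral_const_mul' _ _ ENNReal.ofReal_ne_top]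
          simp_rw [add_mul]
          have hqg : Measurable fun v ↦ q v * ν (Metric.closedBall v R) := hqm.mul hgm
          rw [lintegral_add_left hqg, lintegral_const_mul' _ _ ENNReal.ofReal_ne_top, hint]
      _ ≤ ENNReal.ofReal (2 ^ p) * (ENNReal.ofReal (r ^ p + 2 * (2 * r) ^ p) * V +
            ENNReal.ofReal (R ^ p) * V) := by gcongr
      _ = _ := by
          rw [← add_mul, ← ENNReal.ofReal_add (by positivity) (by positivity), ← mul_assoc,
            ← ENNReal.ofReal_mul (by positivity)]
  refine ((ENNReal.mul_le_mul_iff_left hV0 hVt).1 hmain).trans (ENNReal.ofReal_le_ofReal ?_)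
  have hRr : R ^ p ≤ r ^ p := by
    refine rpow_le_rpow hR.le (by linarith) hp0.le
  have h2p : (2 : ℝ) ≤ 2 ^ p := by
    simpa using rpow_le_rpow_of_exponent_le (by norm_num : (1 : ℝ) ≤ 2) hp
  have e1 : (512 * R) ^ p = 2 ^ p * (2 ^ p * (2 ^ p * (2 ^ p * r ^ p))) := by
    rw [← mul_rpow (by norm_num) hr0.le, ← mul_rpow (by norm_num) (by positivity),
      ← mul_rpow (by norm_num) (by positivity), ← mul_rpow (by norm_num) (by positivity), hr]
    ring_nf
  rw [e1, mul_rpow (by norm_num) hr0.le]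
  have hrp : 0 < r ^ p := by positivity
  set a := (2 : ℝ) ^ p
  have : r ^ p + 2 * (a * r ^ p) + R ^ p ≤ a * (a * (a * r ^ p)) := by
    have h3 : 2 * r ^ p + 2 * (a * r ^ p) ≤ a * (a * (a * r ^ p)) := by
      have : 2 + 2 * a ≤ a * a * a := by nlinarith [mul_nonneg (sub_nonneg.2 h2p) (sub_nonneg.2 h2p)]
      nlinarith
    linarith
  gcongr

end SmallMoment

section Net

variable {E : Type*} [NormedAddCommGroup E] [NormedSpace ℝ E] [FiniteDimensional ℝ E]

open Metric Module

theorem card_le_nine_pow_of_separated (s : Finset E) (hs : ∀ c ∈ s, ‖c‖ ≤ 1)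
    (h : ∀ c ∈ s, ∀ d ∈ s, c ≠ d → 1 / 4 ≤ ‖c - d‖) : s.card ≤ 9 ^ finrank ℝ E := by
  borelize E
  let μ : Measure E := Measure.addHaar
  set A := ⋃ c ∈ s, ball (c : E) (1 / 8) with hA
  have D : Set.Pairwise (s : Set E) (Function.onFun Disjoint fun c ↦ ball (c : E) (1 / 8)) := by
    rintro c hc d hd hcd
    apply ball_disjoint_ball
    rw [dist_eq_norm]
    convert h c hc d hd hcd using 1
    norm_num
  have hsub : A ⊆ ball (0 : E) (9 / 8) := by
    refine Set.iUnion₂_subset fun x hx ↦ ball_subset_ball' ?_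
    have := hs x hx
    rw [dist_zero_right]
    linarith
  have I : (s.card : ℝ≥0∞) * ENNReal.ofReal ((1 / 8) ^ finrank ℝ E) * μ (ball 0 1) ≤
      ENNReal.ofReal ((9 / 8) ^ finrank ℝ E) * μ (ball 0 1) :=
    calc
      _ = μ A := by
        rw [hA, measure_biUnion_finset D fun c _ ↦ measurableSet_ball]
        simp only [μ.addHaar_ball_of_pos _ (show (0 : ℝ) < 1 / 8 by norm_num), Finset.sum_const,
          nsmul_eq_mul, mul_assoc]
      _ ≤ μ (ball (0 : E) (9 / 8)) := measure_mono hsub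
      _ = _ := by simp only [μ.addHaar_ball_of_pos _ (show (0 : ℝ) < 9 / 8 by norm_num)]
  have J := (ENNReal.mul_le_mul_iff_left (measure_ball_pos _ _ zero_lt_one).ne'
    measure_ball_lt_top.ne).1 I
  have K : (s.card : ℝ) ≤ (9 : ℝ) ^ finrank ℝ E := by
    have := ENNReal.toReal_le_of_le_ofReal (by positivity) J
    simpa [div_eq_mul_inv, mul_pow] using this
  exact_mod_cast K

variable (E) in
/-- The unit sphere admits a `1/4`-net of cardinality at most `9 ^ dim E`. -/
theorem exists_net_unit_sphere : ∃ N : Finset E, N.card ≤ 9 ^ finrank ℝ E ∧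
    (∀ s ∈ N, ‖s‖ = 1) ∧ ∀ t : E, ‖t‖ = 1 → ∃ s ∈ N, ‖t - s‖ ≤ 1 / 4 := by
  classical
  let P : Finset E → Prop := fun s ↦
    (∀ c ∈ s, ‖c‖ = 1) ∧ ∀ c ∈ s, ∀ d ∈ s, c ≠ d → 1 / 4 ≤ ‖c - d‖
  have hP : ∀ s, P s → s.card ≤ 9 ^ finrank ℝ E := fun s hs ↦
    card_le_nine_pow_of_separated s (fun c hc ↦ (hs.1 c hc).le) hs.2
  have hbdd : BddAbove {m : ℕ | ∃ s, P s ∧ s.card = m} :=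
    ⟨9 ^ finrank ℝ E, by rintro _ ⟨s, hs, rfl⟩; exact hP s hs⟩
  obtain ⟨N, hN, hcard⟩ := Nat.sSup_mem (s := {m : ℕ | ∃ s, P s ∧ s.card = m})
    ⟨0, ∅, by simp [P], rfl⟩ hbdd
  refine ⟨N, hP N hN, hN.1, fun t ht ↦ ?_⟩
  by_contra! hfar
  have htN : t ∉ N := fun htN ↦ by
    have := hfar t htN
    rw [sub_self, norm_zero] at this
    norm_num at this
  have hins : P (insert t N) := by
    refine ⟨fun c hc ↦ ?_, fun c hc d hd hcd ↦ ?_⟩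
    · rcases Finset.mem_insert.1 hc with rfl | hc
      exacts [ht, hN.1 c hc]
    · rcases Finset.mem_insert.1 hc with hc | hc <;> rcases Finset.mem_insert.1 hd with hd | hd
      · exact absurd (hc.trans hd.symm) hcd
      · exact hc ▸ (hfar d hd).le
      · rw [norm_sub_rev]; exact hd ▸ (hfar c hc).le
      · exact hN.2 c hc d hd hcd
  have := le_csSup hbdd ⟨_, hins, rfl⟩
  rw [← hcard, Finset.card_insert_of_notMem htN] at this
  omega

end Net

section RandomRows

theorem map_sum_smul_pi_stdGaussian {n k : ℕ} (t : EuclideanSpace ℝ (Fin k)) (ht : ‖t‖ = 1) :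
    (Measure.pi fun _ : Fin k ↦ stdGaussian (EuclideanSpace ℝ (Fin n))).map
      (fun G ↦ ∑ i, t i • G i) = stdGaussian (EuclideanSpace ℝ (Fin n)) := by
  apply Measure.ext_of_charFun
  ext u
  rw [iIndepFun.charFun_map_fun_sum_eq_prod
    (X := fun i (G : Fin k → EuclideanSpace ℝ (Fin n)) ↦ t i • G i)
    (fun i ↦ ((measurable_pi_apply i).const_smul (t i)).aemeasurable)
    (iIndepFun_pi (X := fun i (x : EuclideanSpace ℝ (Fin n)) ↦ t i • x) fun i ↦ by fun_prop)]
  have h1 : ∀ i, (Measure.pi fun _ : Fin k ↦ stdGaussian (EuclideanSpace ℝ (Fin n))).map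
      (fun G ↦ t i • G i) = (stdGaussian (EuclideanSpace ℝ (Fin n))).map (t i • ·) := by
    intro i
    have := (measurePreserving_eval
      (fun _ : Fin k ↦ stdGaussian (EuclideanSpace ℝ (Fin n))) i).map_eq
    conv_rhs => rw [← this]
    rw [Measure.map_map (by fun_prop) (by fun_prop)]
    rfl
  have hsum : ∑ i, (t i) ^ 2 = 1 := by
    rw [← EuclideanSpace.real_norm_sq_eq, ht, one_pow]
  simp_rw [h1, Finset.prod_apply, charFun_map_smul, charFun_stdGaussian, ← Complex.exp_sum]
  congr 1
  simp_rw [norm_smul, norm_eq_abs, Complex.ofReal_mul, mul_pow, ← Complex.ofReal_pow, sq_abs]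
  rw [← Finset.sum_div, Finset.sum_neg_distrib, ← Finset.sum_mul, ← Complex.ofReal_sum, hsum]
  simp

theorem measure_integral_add_le_stdGaussian {n : ℕ} {F : EuclideanSpace ℝ (Fin n) → ℝ}
    {L : NNReal} (hF : LipschitzWith L F) (hL : 0 < L) {s : ℝ} (hs : 0 ≤ s) :
    stdGaussian (EuclideanSpace ℝ (Fin n))
      {x | 5 * s * L ≤ F x - ∫ y, F y ∂stdGaussian (EuclideanSpace ℝ (Fin n))} ≤
        ENNReal.ofReal (exp (-(5 * s ^ 2))) := by
  set γ := stdGaussian (EuclideanSpace ℝ (Fin n))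
  set l : NNReal := (2 * s / L).toNNReal with hl
  have hl' : (l : ℝ) = 2 * s / L := Real.coe_toNNReal _ (by positivity)
  have hL' : (0 : ℝ) < L := hL
  have hlF : LipschitzWith (l * L) fun x ↦ l * F x := by
    refine LipschitzWith.of_dist_le_mul fun x y ↦ ?_
    have := hF.dist_le_mul x y
    rw [dist_eq_norm, ← mul_sub, norm_mul, ← dist_eq_norm, NNReal.coe_mul, mul_assoc]
    simpa using mul_le_mul_of_nonneg_left this l.2
  have hc := lintegral_exp_sub_integral_le hlF
  rw [integral_const_mul] at hc
  have hmark := mul_meas_ge_le_lintegral₀ (μ := γ)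
    (f := fun x ↦ ENNReal.ofReal (exp (l * F x - l * ∫ y, F y ∂γ)))
    (by have := hF.continuous.measurable; fun_prop) (ENNReal.ofReal (exp (10 * s ^ 2)))
  have hsub : {x | 5 * s * L ≤ F x - ∫ y, F y ∂γ} ⊆ {x | ENNReal.ofReal (exp (10 * s ^ 2)) ≤
      ENNReal.ofReal (exp (l * F x - l * ∫ y, F y ∂γ))} := by
    intro x hx
    refine ENNReal.ofReal_le_ofReal (exp_le_exp.2 ?_)
    rw [← mul_sub]
    have := mul_le_mul_of_nonneg_left hx l.2
    refine le_trans (le_of_eq ?_) this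
    change _ = (l : ℝ) * _
    rw [hl']
    field_simp
    ring
  have hle : ENNReal.ofReal (exp (π ^ 2 * (l * L : NNReal) ^ 2 / 8)) ≤
      ENNReal.ofReal (exp (5 * s ^ 2)) := by
    refine ENNReal.ofReal_le_ofReal (exp_le_exp.2 ?_)
    rw [NNReal.coe_mul, hl', div_mul_cancel₀ _ hL'.ne']
    have : π ^ 2 ≤ 10 := by nlinarith [pi_gt_three, pi_lt_d2]
    nlinarith [sq_nonneg s]
  have h1 := (mul_le_mul_right (measure_mono hsub) _).trans (hmark.trans (hc.trans hle))
  have h2 : ENNReal.ofReal (exp (5 * s ^ 2)) =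
      ENNReal.ofReal (exp (10 * s ^ 2)) * ENNReal.ofReal (exp (-(5 * s ^ 2))) := by
    rw [← ENNReal.ofReal_mul (exp_pos _).le, ← exp_add]
    congr 2
    ring
  rw [h2] at h1
  exact (ENNReal.mul_le_mul_iff_right (ENNReal.ofReal_pos.2 (exp_pos _)).ne'
    ENNReal.ofReal_ne_top).1 h1

theorem measure_abs_sub_integral_le_stdGaussian {n : ℕ} {F : EuclideanSpace ℝ (Fin n) → ℝ}
    {L : NNReal} (hF : LipschitzWith L F) (hL : 0 < L) {s : ℝ} (hs : 0 ≤ s) :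
    stdGaussian (EuclideanSpace ℝ (Fin n))
      {x | 5 * s * L ≤ |F x - ∫ y, F y ∂stdGaussian (EuclideanSpace ℝ (Fin n))|} ≤
        2 * ENNReal.ofReal (exp (-(5 * s ^ 2))) := by
  have h1 := measure_integral_add_le_stdGaussian hF hL hs
  have h2 := measure_integral_add_le_stdGaussian hF.neg hL hs
  rw [two_mul]
  refine (measure_mono ?_).trans ((measure_union_le _ _).trans (add_le_add h1 h2))
  intro x hx
  rcases le_abs.1 (show 5 * s * L ≤ _ from hx) with hx | hx
  · exact Or.inl hx
  · refine Or.inr ?_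
    change _ ≤ -F x - ∫ y, -F y ∂_
    rw [integral_neg]
    linarith

/-- A seminorm-like function that is nearly constant on a `1/4`-net of the sphere is bounded below
on the whole sphere. -/
theorem le_of_forall_net {E : Type*} [NormedAddCommGroup E] [NormedSpace ℝ E] {g : E → ℝ}
    {N : Finset E} {W τ D : ℝ} (hN : ∀ t : E, ‖t‖ = 1 → ∃ s ∈ N, ‖t - s‖ ≤ 1 / 4)
    (h0 : ∀ t, 0 ≤ g t) (hadd : ∀ s t, g (s + t) ≤ g s + g t)
    (hsmul : ∀ c : ℝ, 0 ≤ c → ∀ t, g (c • t) = c * g t) (hD : ∀ t, g t ≤ D * ‖t‖)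
    (hW : ∀ s ∈ N, |g s - W| ≤ τ) {t : E} (ht : ‖t‖ = 1) : W ≤ 3 / 2 * g t + 2 * τ := by
  set M : ℝ := ⨆ t : {t : E // ‖t‖ = 1}, g t with hM
  have hbdd : BddAbove (Set.range fun t : {t : E // ‖t‖ = 1} ↦ g t) :=
    ⟨D, by rintro _ ⟨t, rfl⟩; simpa [t.2] using hD t⟩
  have hle : ∀ v : E, g v ≤ ‖v‖ * M := by
    intro v
    rcases eq_or_ne v 0 with rfl | hv
    · have := hsmul 0 le_rfl 0
      rw [zero_smul, zero_mul] at this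
      rw [this, norm_zero, zero_mul]
    · have hv' : 0 < ‖v‖ := norm_pos_iff.2 hv
      have hu : ‖‖v‖⁻¹ • v‖ = 1 := by rw [norm_smul, norm_inv, norm_norm, inv_mul_cancel₀ hv'.ne']
      have : g v = ‖v‖ * g (‖v‖⁻¹ • v) := by
        rw [← hsmul _ hv'.le, smul_smul, mul_inv_cancel₀ hv'.ne', one_smul]
      rw [this]
      exact mul_le_mul_of_nonneg_left (le_ciSup hbdd ⟨_, hu⟩) hv'.le
  have hM0 : 0 ≤ M := Real.iSup_nonneg fun t ↦ h0 t
  have hquart : ∀ v : E, ‖v‖ ≤ 1 / 4 → g v ≤ 1 / 4 * M := fun v hv ↦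
    (hle v).trans (mul_le_mul_of_nonneg_right hv hM0)
  have hMle : M ≤ W + τ + 1 / 4 * M := by
    have : Nonempty {t : E // ‖t‖ = 1} := ⟨⟨t, ht⟩⟩
    refine ciSup_le fun u ↦ ?_
    obtain ⟨s, hs, hus⟩ := hN u u.2
    have h1 := hadd s (u - s)
    rw [add_sub_cancel] at h1
    have h2 := (abs_le.1 (hW s hs)).2
    linarith [hquart _ hus]
  obtain ⟨s, hs, hts⟩ := hN t ht
  have h1 := hadd t (s - t)
  rw [add_sub_cancel] at h1
  rw [norm_sub_rev] at hts
  have h2 := (abs_le.1 (hW s hs)).1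
  linarith [hquart _ hts]

theorem ballLogConcave_map {n : ℕ} {μ : Measure Ω} [IsProbabilityMeasure μ]
    {X : Ω → EuclideanSpace ℝ (Fin n)} (hX : Measurable X) (hlc : IsLogConcave μ X)
    {F : Type*} [NormedAddCommGroup F] [InnerProductSpace ℝ F] [MeasurableSpace F]
    [BorelSpace F]
    (T : EuclideanSpace ℝ (Fin n) →L[ℝ] F) (R : ℝ) :
    BallLogConcave (μ.map fun ω ↦ T (X ω)) R := by
  intro u v a ha0 ha1
  set S : F → ℕ → Set (EuclideanSpace ℝ (Fin n)) := fun w M ↦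
    T ⁻¹' Metric.closedBall w R ∩ Metric.closedBall 0 M with hS
  have hTX : Measurable fun ω ↦ T (X ω) := T.continuous.measurable.comp hX
  have hlim : ∀ w, Filter.Tendsto (fun M ↦ μ.real (X ⁻¹' S w M)) Filter.atTop
      (nhds ((μ.map fun ω ↦ T (X ω)).real (Metric.closedBall w R))) := by
    intro w
    rw [measureReal_def, Measure.map_apply hTX Metric.isClosed_closedBall.measurableSet]
    have hU : (fun ω ↦ T (X ω)) ⁻¹' Metric.closedBall w R = ⋃ M, X ⁻¹' S w M := by
      ext ω
      simp only [hS, Set.mem_preimage, Set.mem_iUnion, Set.mem_inter_iff, exists_and_left,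
        mem_closedBall_zero_iff, iff_self_and]
      exact fun _ ↦ exists_nat_ge _
    rw [hU]
    refine (ENNReal.tendsto_toReal (measure_ne_top _ _)).comp
      (tendsto_measure_iUnion_atTop fun M M' hMM' ↦ ?_)
    refine Set.preimage_mono (Set.inter_subset_inter_right _ (Metric.closedBall_subset_closedBall ?_))
    exact_mod_cast hMM'
  have hl := ((hlim u).rpow_const (Or.inr ha0.le)).mul
    ((hlim v).rpow_const (p := 1 - a) (Or.inr (by linarith)))
  refine le_of_tendsto' hl fun M ↦ ?_
  have hcomp : ∀ w, IsCompact (S w M) := fun w ↦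
    (isCompact_closedBall _ _).inter_left (Metric.isClosed_closedBall.preimage T.continuous)
  rcases (S u M).eq_empty_or_nonempty with hu | hu
  · rw [hu, Set.preimage_empty, measureReal_empty, zero_rpow ha0.ne', zero_mul]
    exact measureReal_nonneg
  rcases (S v M).eq_empty_or_nonempty with hv | hv
  · rw [hv, Set.preimage_empty, measureReal_empty, zero_rpow (by linarith), mul_zero]
    exact measureReal_nonneg
  refine (hlc _ _ hu hv (hcomp u) (hcomp v) a ha0.le ha1.le).trans ?_
  rw [measureReal_def, Measure.map_apply hTX Metric.isClosed_closedBall.measurableSet]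
  refine ENNReal.toReal_mono (measure_ne_top _ _) (measure_mono fun ω hω ↦ ?_)
  obtain ⟨_, ⟨x, hx, rfl⟩, _, ⟨y, hy, rfl⟩, hxy⟩ := hω
  have hx1 := mem_closedBall_iff_norm.1 hx.1
  have hy1 := mem_closedBall_iff_norm.1 hy.1
  simp only [] at hxy
  rw [Set.mem_preimage, mem_closedBall_iff_norm, ← hxy, map_add, map_smul, map_smul]
  calc ‖a • T x + (1 - a) • T y - (a • u + (1 - a) • v)‖
      = ‖a • (T x - u) + (1 - a) • (T y - v)‖ := by congr 1; module
    _ ≤ a * R + (1 - a) * R := by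
        refine (norm_add_le _ _).trans (add_le_add ?_ ?_)
        · rw [norm_smul, norm_of_nonneg ha0.le]
          exact mul_le_mul_of_nonneg_left hx1 ha0.le
        · rw [norm_smul, norm_of_nonneg (by linarith)]
          exact mul_le_mul_of_nonneg_left hy1 (by linarith)
    _ = R := by ring

end RandomRows

section PosMoment

variable {n : ℕ} {μ : Measure Ω} {X : Ω → EuclideanSpace ℝ (Fin n)} {p : ℝ}

/-- The `L^p` norm of the positive part of `⟨t, X⟩`. -/
def posMoment (μ : Measure Ω) (X : Ω → EuclideanSpace ℝ (Fin n)) (p : ℝ)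
    (t : EuclideanSpace ℝ (Fin n)) : ℝ :=
  (eLpNorm (fun ω ↦ max ⟪t, X ω⟫ 0) (ENNReal.ofReal p) μ).toReal

theorem posMoment_nonneg (t : EuclideanSpace ℝ (Fin n)) : 0 ≤ posMoment μ X p t :=
  ENNReal.toReal_nonneg

theorem memLp_max_inner (hX : MemLp X (ENNReal.ofReal p) μ) (t : EuclideanSpace ℝ (Fin n)) :
    MemLp (fun ω ↦ max ⟪t, X ω⟫ 0) (ENNReal.ofReal p) μ :=
  (hX.const_inner t).pos_part

theorem posMoment_add_le (hp : 1 ≤ p) (hX : MemLp X (ENNReal.ofReal p) μ)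
    (s t : EuclideanSpace ℝ (Fin n)) :
    posMoment μ X p (s + t) ≤ posMoment μ X p s + posMoment μ X p t := by
  have hs := memLp_max_inner hX s
  have ht := memLp_max_inner hX t
  rw [posMoment, posMoment, posMoment, ← ENNReal.toReal_add hs.2.ne ht.2.ne]
  refine ENNReal.toReal_mono (ENNReal.add_ne_top.2 ⟨hs.2.ne, ht.2.ne⟩) ?_
  refine le_trans (eLpNorm_mono_real fun ω ↦ ?_)
    (eLpNorm_add_le hs.1 ht.1 (ENNReal.one_le_ofReal.2 hp))
  rw [norm_of_nonneg (le_max_right _ _), inner_add_left]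
  exact max_le (add_le_add (le_max_left _ _) (le_max_left _ _))
    (add_nonneg (le_max_right _ _) (le_max_right _ _))

theorem posMoment_smul {c : ℝ} (hc : 0 ≤ c) (t : EuclideanSpace ℝ (Fin n)) :
    posMoment μ X p (c • t) = c * posMoment μ X p t := by
  have : (fun ω ↦ max ⟪c • t, X ω⟫ 0) = c • fun ω ↦ max ⟪t, X ω⟫ 0 := by
    ext ω
    rw [Pi.smul_apply, smul_eq_mul, mul_max_of_nonneg _ _ hc, mul_zero, real_inner_smul_left]
  rw [posMoment, this, eLpNorm_const_smul, ENNReal.toReal_mul, posMoment, toReal_enorm,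
    norm_of_nonneg hc]

theorem ofReal_posMoment_rpow (hp : 1 ≤ p) (hX : MemLp X (ENNReal.ofReal p) μ)
    (t : EuclideanSpace ℝ (Fin n)) :
    ENNReal.ofReal (posMoment μ X p t ^ p) =
      ∫⁻ ω, ENNReal.ofReal ((max ⟪t, X ω⟫ 0) ^ p) ∂μ := by
  have hp0 : 0 < p := by linarith
  rw [← ENNReal.ofReal_rpow_of_nonneg (posMoment_nonneg t) hp0.le, posMoment,
    ENNReal.ofReal_toReal (memLp_max_inner hX t).2.ne,
    eLpNorm_eq_lintegral_rpow_enorm_toReal (by simpa using hp0) ENNReal.ofReal_ne_top,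
    ENNReal.toReal_ofReal hp0.le, ← ENNReal.rpow_mul, one_div, inv_mul_cancel₀ hp0.ne',
    ENNReal.rpow_one]
  refine lintegral_congr fun ω ↦ ?_
  rw [Real.enorm_eq_ofReal (le_max_right _ _),
    ENNReal.ofReal_rpow_of_nonneg (le_max_right _ _) hp0.le]

theorem posMoment_le_sigmaX_mul_norm (hp : 1 ≤ p) (hX : MemLp X (ENNReal.ofReal p) μ)
    (t : EuclideanSpace ℝ (Fin n)) : posMoment μ X p t ≤ sigmaX μ X p * ‖t‖ := by
  have hp0 : 0 < p := by linarith
  have hpe : ENNReal.ofReal p ≠ 0 := by simpa using hp0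
  have hint : ∀ t, (∫ ω, |⟪t, X ω⟫| ^ p ∂μ) ^ (1 / p) =
      (eLpNorm (fun ω ↦ ⟪t, X ω⟫) (ENNReal.ofReal p) μ).toReal := by
    intro t
    rw [(hX.const_inner t).eLpNorm_eq_integral_rpow_norm hpe ENNReal.ofReal_ne_top,
      ENNReal.toReal_ofReal hp0.le, ENNReal.toReal_ofReal (by positivity), one_div]
    rfl
  have hunit : ∀ u : EuclideanSpace ℝ (Fin n), ‖u‖ = 1 → posMoment μ X p u ≤ sigmaX μ X p := by
    intro u hu
    have hbdd : BddAbove (Set.range fun t : {t : EuclideanSpace ℝ (Fin n) // ‖t‖ = 1} ↦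
        (∫ ω, |⟪t.1, X ω⟫| ^ p ∂μ) ^ (1 / p)) := by
      refine ⟨(eLpNorm X (ENNReal.ofReal p) μ).toReal, ?_⟩
      rintro _ ⟨t, rfl⟩
      refine (hint t).le.trans (ENNReal.toReal_mono hX.2.ne (eLpNorm_mono fun ω ↦ ?_))
      simpa [t.2] using norm_inner_le_norm (𝕜 := ℝ) t.1 (X ω)
    refine le_trans ?_ (le_ciSup hbdd ⟨u, hu⟩)
    refine le_trans ?_ (hint u).ge
    refine ENNReal.toReal_mono (hX.const_inner u).2.ne (eLpNorm_mono fun ω ↦ ?_)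
    rw [norm_of_nonneg (le_max_right _ _)]
    exact max_le (le_abs_self _) (abs_nonneg _)
  rcases eq_or_ne t 0 with rfl | ht
  · have := posMoment_smul (μ := μ) (X := X) (p := p) le_rfl (0 : EuclideanSpace ℝ (Fin n))
    rw [zero_smul, zero_mul] at this
    rw [this, norm_zero, mul_zero]
  · have ht' : 0 < ‖t‖ := norm_pos_iff.2 ht
    have hu : ‖‖t‖⁻¹ • t‖ = 1 := by rw [norm_smul, norm_inv, norm_norm, inv_mul_cancel₀ ht'.ne']
    have : posMoment μ X p t = ‖t‖ * posMoment μ X p (‖t‖⁻¹ • t) := by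
      rw [← posMoment_smul ht'.le, smul_smul, mul_inv_cancel₀ ht'.ne', one_smul]
    rw [this, mul_comm]
    exact mul_le_mul_of_nonneg_right (hunit _ hu) ht'.le

theorem lipschitzWith_posMoment (hp : 1 ≤ p) (hX : MemLp X (ENNReal.ofReal p) μ) {B : NNReal}
    (hB : sigmaX μ X p ≤ B) : LipschitzWith B (posMoment μ X p) := by
  have key : ∀ s t, posMoment μ X p s - posMoment μ X p t ≤ B * ‖s - t‖ := by
    intro s t
    have h1 := posMoment_add_le hp hX t (s - t)
    rw [add_sub_cancel] at h1
    have h2 := posMoment_le_sigmaX_mul_norm hp hX (s - t)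
    have h3 := mul_le_mul_of_nonneg_right hB (norm_nonneg (s - t))
    linarith
  refine LipschitzWith.of_dist_le_mul fun s t ↦ ?_
  rw [Real.dist_eq, dist_eq_norm]
  refine abs_sub_le_iff.2 ⟨key s t, ?_⟩
  rw [norm_sub_rev]
  exact key t s

end PosMoment

section Rows

variable {n k : ℕ}

/-- The linear map with rows `Γ i`. -/
def rowMap (Γ : Fin k → EuclideanSpace ℝ (Fin n)) :
    EuclideanSpace ℝ (Fin n) →L[ℝ] EuclideanSpace ℝ (Fin k) :=
  (PiLp.continuousLinearEquiv 2 ℝ (fun _ : Fin k ↦ ℝ)).symm.toContinuousLinearMap ∘L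
    ContinuousLinearMap.pi fun i ↦ innerSL ℝ (Γ i)

theorem rowMap_apply (Γ : Fin k → EuclideanSpace ℝ (Fin n)) (x : EuclideanSpace ℝ (Fin n))
    (i : Fin k) : rowMap Γ x i = ⟪Γ i, x⟫ := rfl

theorem inner_rowMap (Γ : Fin k → EuclideanSpace ℝ (Fin n)) (t : EuclideanSpace ℝ (Fin k))
    (x : EuclideanSpace ℝ (Fin n)) : ⟪t, rowMap Γ x⟫ = ⟪∑ i, t i • Γ i, x⟫ := by
  rw [PiLp.inner_apply, sum_inner]
  refine Finset.sum_congr rfl fun i _ ↦ ?_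
  rw [rowMap_apply, real_inner_smul_left]
  exact mul_comm _ _

theorem map_inner_stdGaussian (x : EuclideanSpace ℝ (Fin n)) :
    (stdGaussian (EuclideanSpace ℝ (Fin n))).map (fun y ↦ ⟪y, x⟫) =
      (gaussianReal 0 1).map (‖x‖ * ·) := by
  have h := IsGaussian.map_eq_gaussianReal (μ := stdGaussian (EuclideanSpace ℝ (Fin n)))
    (innerSL ℝ x)
  rw [integral_strongDual_stdGaussian, variance_dual_stdGaussian, innerSL_apply_norm] at h
  rw [gaussianReal_map_const_mul, mul_zero, mul_one]
  convert h using 2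
  · ext y
    exact real_inner_comm _ _
  · ext
    simp

theorem lintegral_comp_inner_stdGaussian {f : ℝ → ℝ≥0∞} (hf : Measurable f)
    (x : EuclideanSpace ℝ (Fin n)) :
    ∫⁻ y, f ⟪y, x⟫ ∂stdGaussian (EuclideanSpace ℝ (Fin n)) =
      ∫⁻ s, f (‖x‖ * s) ∂gaussianReal 0 1 := by
  rw [← lintegral_map hf (by fun_prop), map_inner_stdGaussian, lintegral_map hf (by fun_prop)]

theorem lintegral_inner_sq_stdGaussian (x : EuclideanSpace ℝ (Fin n)) :
    ∫⁻ y, ENNReal.ofReal (⟪y, x⟫ ^ 2) ∂stdGaussian (EuclideanSpace ℝ (Fin n)) =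
      ENNReal.ofReal (‖x‖ ^ 2) := by
  rw [lintegral_comp_inner_stdGaussian (f := fun s ↦ ENNReal.ofReal (s ^ 2)) (by fun_prop)]
  have hL2 : MemLp (fun s : ℝ ↦ s) 2 (gaussianReal 0 1) := memLp_id_gaussianReal 2
  have hvar : ∫ s, s ^ 2 ∂gaussianReal 0 1 = 1 := by
    have h := variance_of_integral_eq_zero (X := fun s : ℝ ↦ s) (μ := gaussianReal 0 1)
      (by fun_prop) (by simp)
    rw [variance_fun_id_gaussianReal] at h
    exact h.symm
  simp_rw [mul_pow, ENNReal.ofReal_mul (sq_nonneg ‖x‖)]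
  rw [lintegral_const_mul' _ _ ENNReal.ofReal_ne_top,
    ← ofReal_integral_eq_lintegral_ofReal hL2.integrable_sq
      (Filter.Eventually.of_forall fun s ↦ sq_nonneg s), hvar, ENNReal.ofReal_one, mul_one]

theorem measurable_norm_rowMap_sq {X : Ω → EuclideanSpace ℝ (Fin n)} (hX : Measurable X) :
    Measurable fun z : (Fin k → EuclideanSpace ℝ (Fin n)) × Ω ↦
      ENNReal.ofReal (‖rowMap z.1 (X z.2)‖ ^ 2) := by
  simp_rw [EuclideanSpace.real_norm_sq_eq, rowMap_apply]
  fun_prop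

theorem measurable_lintegral_norm_rowMap_sq {μ : Measure Ω} [IsProbabilityMeasure μ]
    {X : Ω → EuclideanSpace ℝ (Fin n)} (hX : Measurable X) :
    Measurable fun Γ : Fin k → EuclideanSpace ℝ (Fin n) ↦
      ∫⁻ ω, ENNReal.ofReal (‖rowMap Γ (X ω)‖ ^ 2) ∂μ :=
  (measurable_norm_rowMap_sq hX).lintegral_prod_right'

theorem lintegral_norm_rowMap_sq {μ : Measure Ω} [IsProbabilityMeasure μ]
    {X : Ω → EuclideanSpace ℝ (Fin n)} (hX : Measurable X) :
    ∫⁻ Γ, (∫⁻ ω, ENNReal.ofReal (‖rowMap Γ (X ω)‖ ^ 2) ∂μ)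
      ∂(Measure.pi fun _ : Fin k ↦ stdGaussian (EuclideanSpace ℝ (Fin n))) =
      k * ∫⁻ ω, ENNReal.ofReal (‖X ω‖ ^ 2) ∂μ := by
  rw [lintegral_lintegral_swap, ← lintegral_const_mul _ (by fun_prop)]
  · refine lintegral_congr fun ω ↦ ?_
    simp_rw [EuclideanSpace.real_norm_sq_eq (rowMap _ _), rowMap_apply]
    simp_rw [ENNReal.ofReal_sum_of_nonneg fun i _ ↦ sq_nonneg _]
    rw [lintegral_finsetSum _ fun i _ ↦ by fun_prop]
    have h : ∀ i : Fin k, ∫⁻ Γ, ENNReal.ofReal (⟪Γ i, X ω⟫ ^ 2)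
        ∂(Measure.pi fun _ : Fin k ↦ stdGaussian (EuclideanSpace ℝ (Fin n))) =
        ENNReal.ofReal (‖X ω‖ ^ 2) := by
      intro i
      rw [← lintegral_inner_sq_stdGaussian]
      exact (measurePreserving_eval (fun _ : Fin k ↦ stdGaussian (EuclideanSpace ℝ (Fin n)))
        i).lintegral_comp (f := fun y ↦ ENNReal.ofReal (⟪y, X ω⟫ ^ 2)) (by fun_prop)
    simp [h]
  · exact (measurable_norm_rowMap_sq hX).aemeasurable

theorem lintegral_norm_sq_of_isIsotropic {μ : Measure Ω}
    {X : Ω → EuclideanSpace ℝ (Fin n)} (hX : Measurable X) (h : IsIsotropic μ X) :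
    ∫⁻ ω, ENNReal.ofReal (‖X ω‖ ^ 2) ∂μ = n := by
  simp_rw [EuclideanSpace.real_norm_sq_eq, ENNReal.ofReal_sum_of_nonneg fun i _ ↦ sq_nonneg _]
  rw [lintegral_finsetSum _ fun i _ ↦ by fun_prop]
  have h1 : ∀ i, ∫⁻ ω, ENNReal.ofReal (X ω i ^ 2) ∂μ = 1 := by
    intro i
    have h2 : ∫ ω, X ω i ^ 2 ∂μ = 1 := by simpa [sq] using h.2 i i
    have hint : Integrable (fun ω ↦ X ω i ^ 2) μ :=
      not_imp_comm.1 integral_undef (by rw [h2]; exact one_ne_zero)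
    rw [← ofReal_integral_eq_lintegral_ofReal hint
      (Filter.Eventually.of_forall fun s ↦ sq_nonneg _), h2, ENNReal.ofReal_one]
  simp [h1]

end Rows

section GaussianMean

variable {n k : ℕ} {μ : Measure Ω} [IsProbabilityMeasure μ] {X : Ω → EuclideanSpace ℝ (Fin n)}
  {p : ℝ} {B : NNReal}

/-- A Gaussian matrix is good with positive probability: the second moment of its image of `X` is
controlled, and `h` is nearly constant on a net of the sphere. -/
theorem exists_good_rows (hXm : Measurable X) (hiso : IsIsotropic μ X) (hB : 0 < B)
    (hn : (n : ℝ) ≤ B ^ 2) (hk : 1 ≤ k) {h : EuclideanSpace ℝ (Fin n) → ℝ} (hh : LipschitzWith B h)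
    (N : Finset (EuclideanSpace ℝ (Fin k))) (hN : N.card ≤ 9 ^ k) (hN1 : ∀ s ∈ N, ‖s‖ = 1) :
    ∃ Γ : Fin k → EuclideanSpace ℝ (Fin n),
      ∫⁻ ω, ENNReal.ofReal (‖rowMap Γ (X ω)‖ ^ 2) ∂μ ≤ ENNReal.ofReal (4 * k * B ^ 2) ∧
      ∀ s ∈ N, |h (∑ i, s i • Γ i) - ∫ x, h x ∂stdGaussian (EuclideanSpace ℝ (Fin n))| ≤
        5 * √k * B := by
  set γ := stdGaussian (EuclideanSpace ℝ (Fin n))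
  set P := Measure.pi fun _ : Fin k ↦ γ
  set W := ∫ x, h x ∂γ
  set q : (Fin k → EuclideanSpace ℝ (Fin n)) → ℝ≥0∞ := fun Γ ↦
    ∫⁻ ω, ENNReal.ofReal (‖rowMap Γ (X ω)‖ ^ 2) ∂μ with hq
  have hB' : (0 : ℝ) < B := hB
  have hk' : (0 : ℝ) < k := by exact_mod_cast hk
  have hqm : Measurable q := measurable_lintegral_norm_rowMap_sq hXm
  have hA : P {Γ | ENNReal.ofReal (4 * k * B ^ 2) ≤ q Γ} ≤ ENNReal.ofReal (1 / 4) := by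
    have h1 := mul_meas_ge_le_lintegral₀ (μ := P) hqm.aemeasurable
      (ENNReal.ofReal (4 * k * B ^ 2))
    rw [lintegral_norm_rowMap_sq hXm, lintegral_norm_sq_of_isIsotropic hXm hiso] at h1
    have h2 : (k : ℝ≥0∞) * n ≤ ENNReal.ofReal (4 * k * B ^ 2) * ENNReal.ofReal (1 / 4) := by
      rw [← ENNReal.ofReal_natCast, ← ENNReal.ofReal_natCast n, ← ENNReal.ofReal_mul (by positivity),
        ← ENNReal.ofReal_mul (by positivity)]
      refine ENNReal.ofReal_le_ofReal ?_
      nlinarith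
    refine (ENNReal.mul_le_mul_iff_right ?_ ENNReal.ofReal_ne_top).1 (h1.trans h2)
    exact (ENNReal.ofReal_pos.2 (by positivity)).ne'
  have hS : ∀ s ∈ N, P {Γ | 5 * √k * B ≤ |h (∑ i, s i • Γ i) - W|} ≤
      2 * ENNReal.ofReal (exp (-(5 * k))) := by
    intro s hs
    have h1 := measure_abs_sub_integral_le_stdGaussian hh hB (sqrt_nonneg (k : ℝ))
    rw [Real.sq_sqrt hk'.le] at h1
    refine le_trans (le_of_eq ?_) h1
    have h2 := map_sum_smul_pi_stdGaussian (n := n) s (hN1 s hs)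
    conv_rhs => rw [← h2]
    rw [Measure.map_apply (by fun_prop) (measurableSet_le measurable_const
      (by have := hh.continuous.measurable; fun_prop))]
    rw [h2]
    rfl
  have hU : P (⋃ s ∈ N, {Γ | 5 * √k * B ≤ |h (∑ i, s i • Γ i) - W|}) ≤ ENNReal.ofReal (1 / 2) := by
    refine (measure_biUnion_finset_le _ _).trans ((Finset.sum_le_sum hS).trans ?_)
    rw [Finset.sum_const, nsmul_eq_mul, ← ENNReal.ofReal_ofNat, ← ENNReal.ofReal_natCast,
      ← ENNReal.ofReal_mul (by norm_num), ← ENNReal.ofReal_mul (by positivity)]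
    refine ENNReal.ofReal_le_ofReal ?_
    have he : exp (-(5 * k)) ≤ (1 / 36 : ℝ) ^ k := by
      have : exp (-(5 * k)) = (exp (-5)) ^ k := by rw [← exp_nat_mul]; ring_nf
      rw [this]
      refine pow_le_pow_left₀ (exp_pos _).le ?_ _
      rw [exp_neg, one_div]
      refine inv_anti₀ (by norm_num) ?_
      have h27 : (2.7 : ℝ) ≤ exp 1 := by linarith [exp_one_gt_d9]
      calc (36 : ℝ) ≤ 2.7 ^ 5 := by norm_num
        _ ≤ exp 1 ^ 5 := pow_le_pow_left₀ (by norm_num) h27 _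
        _ = exp 5 := by rw [← exp_nat_mul]; norm_num
    have hc : (N.card : ℝ) ≤ 9 ^ k := by exact_mod_cast hN
    calc (N.card : ℝ) * (2 * exp (-(5 * k))) ≤ 9 ^ k * (2 * (1 / 36) ^ k) := by gcongr
      _ = 2 * (1 / 4) ^ k := by rw [mul_left_comm, ← mul_pow]; norm_num
      _ ≤ 2 * (1 / 4) ^ 1 := by
          gcongr 2 * ?_
          exact pow_le_pow_of_le_one (by norm_num) (by norm_num) hk
      _ = 1 / 2 := by norm_num
  by_contra! hcon
  have huniv : Set.univ ⊆ {Γ | ENNReal.ofReal (4 * k * B ^ 2) ≤ q Γ} ∪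
      ⋃ s ∈ N, {Γ | 5 * √k * B ≤ |h (∑ i, s i • Γ i) - W|} := by
    intro Γ _
    by_cases hΓ : q Γ ≤ ENNReal.ofReal (4 * k * B ^ 2)
    · obtain ⟨s, hs, hlt⟩ := hcon Γ hΓ
      exact Or.inr (Set.mem_biUnion hs hlt.le)
    · exact Or.inl (not_le.1 hΓ).le
  have h1 := (measure_mono (μ := P) huniv).trans ((measure_union_le _ _).trans (add_le_add hA hU))
  rw [measure_univ, ← ENNReal.ofReal_add (by norm_num) (by norm_num), ENNReal.one_le_ofReal] at h1
  norm_num at h1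

theorem integral_posMoment_le (hXm : Measurable X) (hlc : IsLogConcave μ X)
    (hiso : IsIsotropic μ X) (hp : 1 ≤ p) (hX : MemLp X (ENNReal.ofReal p) μ) (hB : 0 < B)
    (hσ : sigmaX μ X p ≤ B) (hn : (n : ℝ) ≤ B ^ 2) (hpk : p ≤ k) :
    ∫ x, posMoment μ X p x ∂stdGaussian (EuclideanSpace ℝ (Fin n)) ≤ 2400 * √k * B := by
  have hp0 : 0 < p := by linarith
  have hk1 : 1 ≤ k := by
    have : (1 : ℝ) ≤ k := hp.trans hpk
    exact_mod_cast this
  have hk' : (0 : ℝ) < k := by exact_mod_cast hk1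
  have hB' : (0 : ℝ) < B := hB
  obtain ⟨N, hNc, hN1, hNnet⟩ := exists_net_unit_sphere (EuclideanSpace ℝ (Fin k))
  rw [finrank_euclideanSpace_fin] at hNc
  obtain ⟨Γ, hΓ2, hΓN⟩ := exists_good_rows hXm hiso hB hn hk1 (lipschitzWith_posMoment hp hX hσ)
    N hNc hN1
  set R : ℝ := √(8 * k) * B with hR
  have hR0 : 0 < R := by positivity
  have hR2 : R ^ 2 = 8 * k * B ^ 2 := by rw [hR, mul_pow, Real.sq_sqrt (by positivity)]
  have hTm : Measurable fun ω ↦ rowMap Γ (X ω) := (rowMap Γ).continuous.measurable.comp hXm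
  set ν := μ.map fun ω ↦ rowMap Γ (X ω) with hν
  have : IsProbabilityMeasure ν := Measure.isProbabilityMeasure_map hTm.aemeasurable
  have hball : 1 / 2 ≤ ν.real (Metric.closedBall 0 R) := by
    have hc : ν (Metric.closedBall 0 R)ᶜ ≤ ENNReal.ofReal (1 / 2) := by
      rw [hν, Measure.map_apply hTm Metric.isClosed_closedBall.measurableSet.compl]
      have h1 := mul_meas_ge_le_lintegral₀ (μ := μ)
        (f := fun ω ↦ ENNReal.ofReal (‖rowMap Γ (X ω)‖ ^ 2)) (by fun_prop)
        (ENNReal.ofReal (R ^ 2))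
      have h2 : ENNReal.ofReal (4 * k * B ^ 2) = ENNReal.ofReal (R ^ 2) * ENNReal.ofReal (1 / 2) := by
        rw [← ENNReal.ofReal_mul (by positivity), hR2]
        congr 1
        ring
      rw [h2] at hΓ2
      refine le_trans (measure_mono fun ω hω ↦ ?_) ((ENNReal.mul_le_mul_iff_right
        (ENNReal.ofReal_pos.2 (by positivity)).ne' ENNReal.ofReal_ne_top).1 (h1.trans hΓ2))
      have hω' : ¬ ‖rowMap Γ (X ω)‖ ≤ R := fun hle ↦ hω (mem_closedBall_zero_iff.2 hle)
      exact ENNReal.ofReal_le_ofReal (pow_le_pow_left₀ hR0.le (not_le.1 hω').le 2)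
    have h3 := ENNReal.toReal_le_of_le_ofReal (by norm_num) hc
    rw [← measureReal_def, probReal_compl_eq_one_sub Metric.isClosed_closedBall.measurableSet] at h3
    linarith
  have hfin : ∫⁻ y, ENNReal.ofReal (‖y‖ ^ p) ∂ν < ∞ := by
    rw [hν, lintegral_map (by fun_prop) hTm]
    have h1 : MemLp (fun ω ↦ rowMap Γ (X ω)) (ENNReal.ofReal p) μ :=
      (rowMap Γ).comp_memLp' hX
    have h2 := (integrable_norm_rpow_iff h1.1 (by simpa using hp0) ENNReal.ofReal_ne_top).2 h1
    rw [ENNReal.toReal_ofReal hp0.le] at h2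
    exact h2.lintegral_lt_top
  obtain ⟨t, ht, hle⟩ := exists_unit_lintegral_posPart_rpow_le (ballLogConcave_map hXm hlc _ R) hR0
    hp (by rwa [finrank_euclideanSpace_fin]) hball hfin
  rw [lintegral_map (by fun_prop) hTm] at hle
  simp_rw [inner_rowMap] at hle
  rw [← ofReal_posMoment_rpow hp hX, ENNReal.ofReal_le_ofReal_iff (by positivity),
    rpow_le_rpow_iff (posMoment_nonneg _) (by positivity) hp0] at hle
  have hsum : ∀ c : ℝ, ∀ t : EuclideanSpace ℝ (Fin k), ∑ i, (c • t) i • Γ i =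
      c • ∑ i, t i • Γ i := by
    intro c t
    simp [Finset.smul_sum, mul_smul]
  have hnet := le_of_forall_net (g := fun t : EuclideanSpace ℝ (Fin k) ↦
    posMoment μ X p (∑ i, t i • Γ i)) (D := B * ∑ i, ‖Γ i‖) hNnet (fun t ↦ posMoment_nonneg _)
    (fun s t ↦ by simpa [add_smul, Finset.sum_add_distrib] using posMoment_add_le hp hX _ _)
    (fun c hc t ↦ by
      change posMoment μ X p (∑ i, (c • t) i • Γ i) = _
      rw [hsum, posMoment_smul hc]) (fun t ↦ ?_) hΓN ht
  · have hs8 : √(8 * k) ≤ 3 * √k := by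
      rw [Real.sqrt_mul (by norm_num)]
      refine mul_le_mul_of_nonneg_right ?_ (sqrt_nonneg _)
      exact Real.sqrt_le_iff.2 ⟨by norm_num, by norm_num⟩
    have : R ≤ 3 * √k * B := mul_le_mul_of_nonneg_right hs8 hB'.le
    have h0 : 0 ≤ √k * B := by positivity
    nlinarith
  · refine (posMoment_le_sigmaX_mul_norm hp hX _).trans ?_
    rw [mul_assoc]
    refine mul_le_mul hσ ?_ (norm_nonneg _) hB'.le
    rw [Finset.sum_mul]
    refine (norm_sum_le _ _).trans (Finset.sum_le_sum fun i _ ↦ ?_)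
    rw [norm_smul, mul_comm]
    exact mul_le_mul_of_nonneg_left (PiLp.norm_apply_le t i) (norm_nonneg _)

end GaussianMean

section Assembly

theorem ofReal_rpow_le_lintegral_gaussianReal {p : ℝ} (hp : 1 ≤ p) :
    ENNReal.ofReal ((exp (-3) * √p) ^ p) ≤
      ∫⁻ s, ENNReal.ofReal ((max s 0) ^ p) ∂gaussianReal 0 1 := by
  have hp0 : 0 < p := by linarith
  have hsp : 1 ≤ √p := Real.one_le_sqrt.2 hp
  have hsq : √p ^ 2 = p := Real.sq_sqrt hp0.le
  set I := Set.Icc √p (√p + 1)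
  have hI : MeasurableSet I := measurableSet_Icc
  have hγ : ENNReal.ofReal (exp (-(3 * p))) ≤ gaussianReal 0 1 I := by
    rw [gaussianReal_apply _ one_ne_zero]
    have hpdf : ∀ x ∈ I, ENNReal.ofReal (exp (-(3 * p))) ≤ gaussianPDF 0 1 x := by
      intro x hx
      refine ENNReal.ofReal_le_ofReal ?_
      rw [gaussianPDFReal]
      have h2π : √(2 * π) ≤ exp p := by
        have h1 : exp 1 ≤ exp p := exp_le_exp.2 hp
        have h2 : √(2 * π) ≤ 2.7 := Real.sqrt_le_iff.2 ⟨by norm_num, by linarith [pi_lt_d2]⟩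
        linarith [exp_one_gt_d9]
      have hx2 : x ^ 2 ≤ 4 * p := by
        have h0 : 0 ≤ x := by linarith [hx.1]
        nlinarith [hx.2]
      have hinv : exp (-p) ≤ (√(2 * π))⁻¹ := by
        rw [exp_neg]
        exact inv_anti₀ (by positivity) h2π
      calc exp (-(3 * p)) = exp (-p) * exp (-(2 * p)) := by rw [← exp_add]; ring_nf
        _ ≤ (√(2 * π))⁻¹ * exp (-x ^ 2 / 2) := by
            gcongr
            linarith
        _ = _ := by simp
    calc ENNReal.ofReal (exp (-(3 * p))) = ∫⁻ _ in I, ENNReal.ofReal (exp (-(3 * p))) := by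
          rw [setLIntegral_const, Real.volume_Icc]; simp
      _ ≤ _ := setLIntegral_mono' hI hpdf
  calc ENNReal.ofReal ((exp (-3) * √p) ^ p)
      = ENNReal.ofReal (√p ^ p) * ENNReal.ofReal (exp (-(3 * p))) := by
        rw [mul_rpow (exp_pos _).le (by positivity), ← exp_mul, mul_comm,
          ENNReal.ofReal_mul (by positivity)]
        ring_nf
    _ ≤ ENNReal.ofReal (√p ^ p) * gaussianReal 0 1 I := mul_le_mul_right hγ _
    _ = ∫⁻ _ in I, ENNReal.ofReal (√p ^ p) ∂gaussianReal 0 1 := by rw [setLIntegral_const]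
    _ ≤ ∫⁻ s in I, ENNReal.ofReal ((max s 0) ^ p) ∂gaussianReal 0 1 := by
        refine setLIntegral_mono' hI fun s hs ↦ ENNReal.ofReal_le_ofReal ?_
        exact rpow_le_rpow (by positivity) (hs.1.trans (le_max_left _ _)) hp0.le
    _ ≤ _ := setLIntegral_le_lintegral _ _

theorem lintegral_rpow_le_stdGaussian {n : ℕ} {p : ℝ} (hp : 1 ≤ p)
    {h : EuclideanSpace ℝ (Fin n) → ℝ} {B : NNReal} (hB : 0 < B) (hh : LipschitzWith B h)
    (h0 : ∀ x, 0 ≤ h x) :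
    ∫⁻ x, ENNReal.ofReal (h x ^ p) ∂stdGaussian (EuclideanSpace ℝ (Fin n)) ≤
      ENNReal.ofReal
        ((exp 3 * (∫ x, h x ∂stdGaussian (EuclideanSpace ℝ (Fin n)) + √p * B)) ^ p) := by
  set γ := stdGaussian (EuclideanSpace ℝ (Fin n))
  set W := ∫ x, h x ∂γ with hW
  have hp0 : 0 < p := by linarith
  have hB' : (0 : ℝ) < B := hB
  have hW0 : 0 ≤ W := integral_nonneg h0
  have hpB : 0 < √p * B := by positivity
  set V := W + √p * B with hV
  have hV0 : 0 < V := by positivity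
  set l : NNReal := (p / V).toNNReal
  have hl : (l : ℝ) = p / V := Real.coe_toNNReal _ (by positivity)
  have hlF : LipschitzWith (l * B) fun x ↦ l * h x := by
    refine LipschitzWith.of_dist_le_mul fun x y ↦ ?_
    have := hh.dist_le_mul x y
    rw [dist_eq_norm, ← mul_sub, norm_mul, ← dist_eq_norm, NNReal.coe_mul, mul_assoc]
    simpa using mul_le_mul_of_nonneg_left this l.2
  have hc := lintegral_exp_sub_integral_le hlF
  rw [integral_const_mul] at hc
  have hpt : ∀ x, ENNReal.ofReal (h x ^ p) ≤
      ENNReal.ofReal (V ^ p * exp (l * W)) * ENNReal.ofReal (exp (l * h x - l * W)) := by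
    intro x
    rw [← ENNReal.ofReal_mul (by positivity), mul_assoc, ← exp_add, add_sub_cancel]
    refine ENNReal.ofReal_le_ofReal ?_
    have hx : h x ≤ V * exp (h x / V) := by
      have h1 : h x / V ≤ exp (h x / V) := by linarith [add_one_le_exp (h x / V)]
      calc h x = V * (h x / V) := by field_simp
        _ ≤ _ := mul_le_mul_of_nonneg_left h1 hV0.le
    calc h x ^ p ≤ (V * exp (h x / V)) ^ p := rpow_le_rpow (h0 x) hx hp0.le
      _ = V ^ p * exp (l * h x) := by
          rw [mul_rpow hV0.le (exp_pos _).le, ← exp_mul, hl]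
          congr 2
          ring
  have hexp : l * W + π ^ 2 * (l * B) ^ 2 / 8 ≤ 3 * p := by
    have h1 : (l : ℝ) * W ≤ p := by
      rw [hl, div_mul_eq_mul_div, div_le_iff₀ hV0]
      exact mul_le_mul_of_nonneg_left (by linarith) hp0.le
    have h2 : (l * B : ℝ) ≤ √p := by
      rw [hl, div_mul_eq_mul_div, div_le_iff₀ hV0]
      nth_rewrite 1 [← Real.mul_self_sqrt hp0.le]
      rw [mul_assoc]
      exact mul_le_mul_of_nonneg_left (by linarith) (sqrt_nonneg _)
    have h3 : (l * B : ℝ) ^ 2 ≤ p := by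
      rw [← Real.sq_sqrt hp0.le]
      exact pow_le_pow_left₀ (by positivity) h2 2
    have : π ^ 2 ≤ 10 := by nlinarith [pi_gt_three, pi_lt_d2]
    nlinarith [sq_nonneg (l * B : ℝ)]
  calc ∫⁻ x, ENNReal.ofReal (h x ^ p) ∂γ
      ≤ ∫⁻ x, ENNReal.ofReal (V ^ p * exp (l * W)) *
          ENNReal.ofReal (exp (l * h x - l * W)) ∂γ := lintegral_mono hpt
    _ ≤ ENNReal.ofReal (V ^ p * exp (l * W)) *
          ENNReal.ofReal (exp (π ^ 2 * (l * B : NNReal) ^ 2 / 8)) := by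
        rw [lintegral_const_mul' _ _ ENNReal.ofReal_ne_top]
        exact mul_le_mul_right hc _
    _ ≤ _ := by
        rw [← ENNReal.ofReal_mul (by positivity), mul_assoc, ← exp_add, NNReal.coe_mul]
        refine ENNReal.ofReal_le_ofReal ?_
        rw [mul_rpow (exp_pos _).le hV0.le, ← exp_mul, mul_comm]
        gcongr

theorem lintegral_posMoment_rpow {n : ℕ} {μ : Measure Ω} [IsProbabilityMeasure μ]
    {X : Ω → EuclideanSpace ℝ (Fin n)} {p : ℝ} (hXm : Measurable X) (hp : 1 ≤ p)
    (hX : MemLp X (ENNReal.ofReal p) μ) :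
    ∫⁻ x, ENNReal.ofReal (posMoment μ X p x ^ p) ∂stdGaussian (EuclideanSpace ℝ (Fin n)) =
      (∫⁻ s, ENNReal.ofReal ((max s 0) ^ p) ∂gaussianReal 0 1) *
        ∫⁻ ω, ENNReal.ofReal (‖X ω‖ ^ p) ∂μ := by
  simp_rw [ofReal_posMoment_rpow hp hX]
  rw [lintegral_lintegral_swap (by fun_prop), ← lintegral_const_mul _ (by fun_prop)]
  refine lintegral_congr fun ω ↦ ?_
  rw [lintegral_comp_inner_stdGaussian (f := fun s ↦ ENNReal.ofReal ((max s 0) ^ p))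
    (by fun_prop), mul_comm, ← lintegral_const_mul _ (by fun_prop)]
  refine lintegral_congr fun s ↦ ?_
  rw [← ENNReal.ofReal_mul (by positivity), ← mul_rpow (norm_nonneg _) (le_max_right _ _),
    mul_max_of_nonneg _ _ (norm_nonneg _), mul_zero]

theorem lintegral_norm_rpow_le {n : ℕ} {μ : Measure Ω} [IsProbabilityMeasure μ]
    {X : Ω → EuclideanSpace ℝ (Fin n)} {p : ℝ} (hXm : Measurable X) (hlc : IsLogConcave μ X)
    (hiso : IsIsotropic μ X) (hp : 1 ≤ p) (hX : MemLp X (ENNReal.ofReal p) μ) {B : NNReal}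
    (hB : 0 < B) (hσ : sigmaX μ X p ≤ B) (hn : (n : ℝ) ≤ B ^ 2) :
    ∫⁻ ω, ENNReal.ofReal (‖X ω‖ ^ p) ∂μ ≤ ENNReal.ofReal ((3601 * exp 6 * B) ^ p) := by
  have hp0 : 0 < p := by linarith
  have hB' : (0 : ℝ) < B := hB
  have hsp : 0 < √p := Real.sqrt_pos.2 hp0
  have hW := integral_posMoment_le hXm hlc hiso hp hX hB hσ hn (Nat.le_ceil p)
  have hk : √(⌈p⌉₊ : ℝ) ≤ 3 / 2 * √p := by
    refine Real.sqrt_le_iff.2 ⟨by positivity, ?_⟩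
    rw [mul_pow, Real.sq_sqrt hp0.le]
    linarith [Nat.ceil_lt_add_one hp0.le]
  have hup := lintegral_rpow_le_stdGaussian hp hB (lipschitzWith_posMoment hp hX hσ)
    posMoment_nonneg
  rw [lintegral_posMoment_rpow hXm hp hX] at hup
  have hlow := (mul_le_mul_left (ofReal_rpow_le_lintegral_gaussianReal hp) _).trans hup
  set W := ∫ x, posMoment μ X p x ∂stdGaussian (EuclideanSpace ℝ (Fin n))
  have hW0 : 0 ≤ W := integral_nonneg posMoment_nonneg
  have hWle : W + √p * B ≤ 3601 * (√p * B) := by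
    have : √(⌈p⌉₊ : ℝ) * B ≤ 3 / 2 * √p * B := mul_le_mul_of_nonneg_right hk hB'.le
    nlinarith
  have hcmp : ENNReal.ofReal ((exp 3 * (W + √p * B)) ^ p) ≤
      ENNReal.ofReal ((exp (-3) * √p) ^ p) * ENNReal.ofReal ((3601 * exp 6 * B) ^ p) := by
    rw [← ENNReal.ofReal_mul (by positivity), ← mul_rpow (by positivity) (by positivity)]
    refine ENNReal.ofReal_le_ofReal (rpow_le_rpow (by positivity) ?_ hp0.le)
    have he : exp 3 = exp (-3) * exp 6 := by rw [← exp_add]; norm_num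
    calc exp 3 * (W + √p * B) ≤ exp 3 * (3601 * (√p * B)) := by gcongr
      _ = _ := by rw [he]; ring
  exact (ENNReal.mul_le_mul_iff_right (ENNReal.ofReal_pos.2 (by positivity)).ne'
    ENNReal.ofReal_ne_top).1 (hlow.trans hcmp)

end Assembly

/-- **Paouris inequality.** There is a universal constant `C > 0` such that for every isotropic
log-concave random vector `X` in `ℝⁿ` and every `p ≥ 1`,
`(E|X|^p)^(1/p) ≤ C·(√n + σ_X(p))`. -/
theorem paouris :
    ∃ C : ℝ, 0 < C ∧
      ∀ (Ω : Type) (_ : MeasurableSpace Ω) (μ : Measure Ω), IsProbabilityMeasure μ →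
      ∀ (n : ℕ) (X : Ω → EuclideanSpace ℝ (Fin n)), Measurable X →
      IsLogConcave μ X → IsIsotropic μ X →
      ∀ p : ℝ, 1 ≤ p →
        (∫ ω, ‖X ω‖ ^ p ∂μ) ^ (1 / p) ≤ C * (Real.sqrt n + sigmaX μ X p) := by
  refine ⟨3601 * exp 6, by positivity, fun Ω _ μ _ n X hXm hlc hiso p hp ↦ ?_⟩
  have hp0 : 0 < p := by linarith
  have hσ0 : 0 ≤ sigmaX μ X p := Real.iSup_nonneg fun t ↦
    rpow_nonneg (integral_nonneg fun ω ↦ rpow_nonneg (abs_nonneg _) _) _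
  by_cases hint : Integrable (fun ω ↦ ‖X ω‖ ^ p) μ
  · rcases Nat.eq_zero_or_pos n with rfl | hn
    · have hX0 : ∀ ω, ‖X ω‖ ^ p = 0 := fun ω ↦ by
        rw [Subsingleton.elim (X ω) 0, norm_zero, zero_rpow hp0.ne']
      simp_rw [hX0, integral_zero]
      rw [zero_rpow (by positivity)]
      positivity
    have hn' : 0 < √(n : ℝ) := Real.sqrt_pos.2 (by exact_mod_cast hn)
    set B : NNReal := ⟨√n + sigmaX μ X p, by positivity⟩
    have hX : MemLp X (ENNReal.ofReal p) μ := by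
      rw [← integrable_norm_rpow_iff hXm.aestronglyMeasurable (by simpa using hp0)
        ENNReal.ofReal_ne_top, ENNReal.toReal_ofReal hp0.le]
      exact hint
    have hnB : (n : ℝ) ≤ (B : ℝ) ^ 2 := by
      change (n : ℝ) ≤ (√n + sigmaX μ X p) ^ 2
      nlinarith [Real.sq_sqrt (Nat.cast_nonneg (α := ℝ) n)]
    have h := lintegral_norm_rpow_le hXm hlc hiso hp hX (B := B)
      (show (0 : ℝ) < √n + sigmaX μ X p by positivity)
      (show sigmaX μ X p ≤ √n + sigmaX μ X p by linarith) hnB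
    rw [← ofReal_integral_eq_lintegral_ofReal hint
      (Filter.Eventually.of_forall fun ω ↦ by positivity),
      ENNReal.ofReal_le_ofReal_iff (by positivity)] at h
    have h2 := rpow_le_rpow (z := 1 / p) (integral_nonneg fun ω ↦ by positivity) h (by positivity)
    rwa [← rpow_mul (by positivity), mul_one_div_cancel hp0.ne', rpow_one] at h2
  · rw [integral_undef hint, zero_rpow (by positivity)]
    positivity

end
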